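/- Let ℓ, m be positive integers. If A ⊆ ℕ satisfies d_(A) + d̄(A) > 2 − 1/(ℓ+m), then there exists an infinite set B ⊆ ℕ such that {m·b₁ + ℓ·b₂ : b₁, b₂ ∈ B and b₁ ≤ b₂} ⊆ A. -/

import Mathlib

open Filter MeasureTheory Topology

open scoped Classical in
/-- Upper Banach density: `limsup` over window length `N` of the maximal count of
elements of `A` in a window of length `N`, divided by `N`. -/
noncomputable def upperBanachDensity (A : Set ℕ) : ℝ :=
  Filter.limsup
    (fun N : ℕ => ⨆ M : ℕ, (((Finset.Ico M (M + N)).filter (· ∈ A)).card : ℝ) / N)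
    Filter.atTop

open scoped Classical in
/-- Natural upper density of a set of naturals. -/
noncomputable def upperDensity (A : Set ℕ) : ℝ :=
  Filter.limsup (fun N : ℕ => (((Finset.Icc 1 N).filter (· ∈ A)).card : ℝ) / N)
    Filter.atTop

open scoped Classical in
/-- Natural lower density of a set of naturals. -/
noncomputable def lowerDensity (A : Set ℕ) : ℝ :=
  Filter.liminf (fun N : ℕ => (((Finset.Icc 1 N).filter (· ∈ A)).card : ℝ) / N)
    Filter.atTop


namespace MBLB

/-- Bounded real functions. -/
@[fun_prop]
def Bdd {X : Type} (f : X → ℝ) : Prop := ∃ C, ∀ x, |f x| ≤ C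

theorem Bdd.pos {X : Type} {f : X → ℝ} (h : Bdd f) : ∃ C, 0 < C ∧ ∀ x, |f x| ≤ C := by
  obtain ⟨C, hC⟩ := h
  exact ⟨max C 1, by positivity, fun x => (hC x).trans (le_max_left _ _)⟩

@[fun_prop] theorem Bdd.comp {X Y : Type} {f : X → ℝ} (h : Bdd f) (g : Y → X) : Bdd (fun y => f (g y)) := by
  obtain ⟨C, hC⟩ := h
  exact ⟨C, fun x => hC _⟩

@[fun_prop] theorem bdd_const {X : Type} (c : ℝ) : Bdd (fun _ : X => c) := ⟨|c|, fun _ => le_rfl⟩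

@[fun_prop] theorem bdd_add {X : Type} {f g : X → ℝ} (hf : Bdd f) (hg : Bdd g) :
    Bdd (fun x => f x + g x) := by
  obtain ⟨C, hC⟩ := hf
  obtain ⟨D, hD⟩ := hg
  exact ⟨C + D, fun x => (abs_add_le _ _).trans (add_le_add (hC x) (hD x))⟩

@[fun_prop] theorem bdd_neg {X : Type} {f : X → ℝ} (hf : Bdd f) : Bdd (fun x => - f x) := by
  obtain ⟨C, hC⟩ := hf
  exact ⟨C, fun x => by simpa using hC x⟩

@[fun_prop] theorem bdd_sub {X : Type} {f g : X → ℝ} (hf : Bdd f) (hg : Bdd g) :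
    Bdd (fun x => f x - g x) := by
  obtain ⟨C, hC⟩ := hf
  obtain ⟨D, hD⟩ := hg
  exact ⟨C + D, fun x => (abs_sub _ _).trans (add_le_add (hC x) (hD x))⟩

@[fun_prop] theorem bdd_mul {X : Type} {f g : X → ℝ} (hf : Bdd f) (hg : Bdd g) :
    Bdd (fun x => f x * g x) := by
  obtain ⟨C, hC⟩ := hf
  obtain ⟨D, hD⟩ := hg
  exact ⟨C * D, fun x => by
    rw [abs_mul]
    exact mul_le_mul (hC x) (hD x) (abs_nonneg _) ((abs_nonneg _).trans (hC x))⟩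

@[fun_prop] theorem bdd_pow {X : Type} {f : X → ℝ} (hf : Bdd f) (k : ℕ) :
    Bdd (fun x => f x ^ k) := by
  obtain ⟨C, hC⟩ := hf
  exact ⟨C ^ k, fun x => by rw [abs_pow]; exact pow_le_pow_left₀ (abs_nonneg _) (hC x) k⟩

@[fun_prop] theorem bdd_abs {X : Type} {f : X → ℝ} (hf : Bdd f) : Bdd (fun x => |f x|) := by
  obtain ⟨C, hC⟩ := hf
  exact ⟨C, fun x => by simpa using hC x⟩

@[fun_prop] theorem bdd_div {X : Type} {f : X → ℝ} (hf : Bdd f) (c : ℝ) :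
    Bdd (fun x => f x / c) := by
  simp only [div_eq_mul_inv]
  exact bdd_mul hf (bdd_const _)

@[fun_prop] theorem bdd_max {X : Type} {f g : X → ℝ} (hf : Bdd f) (hg : Bdd g) :
    Bdd (fun x => max (f x) (g x)) := by
  obtain ⟨C, hC⟩ := hf
  obtain ⟨D, hD⟩ := hg
  refine ⟨max C D, fun x => ?_⟩
  exact (abs_max_le_max_abs_abs).trans (max_le_max (hC x) (hD x))

@[fun_prop] theorem bdd_sum {X ι : Type} (s : Finset ι) {f : ι → X → ℝ} (hf : ∀ i, Bdd (f i)) :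
    Bdd (fun x => ∑ i ∈ s, f i x) := by
  classical
  induction s using Finset.induction_on with
  | empty => simpa using bdd_const 0
  | insert a s ha ih => simp only [Finset.sum_insert ha]; exact bdd_add (hf a) ih

abbrev Fn := (ℤ → ℝ) →ₗ[ℝ] ℝ

theorem Fn.add (M : Fn) (f g : ℤ → ℝ) : M (fun n => f n + g n) = M f + M g := M.map_add f g
theorem Fn.sub (M : Fn) (f g : ℤ → ℝ) : M (fun n => f n - g n) = M f - M g := M.map_sub f g
theorem Fn.neg (M : Fn) (f : ℤ → ℝ) : M (fun n => - f n) = - M f := M.map_neg f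
theorem Fn.cmul (M : Fn) (c : ℝ) (f : ℤ → ℝ) : M (fun n => c * f n) = c * M f := M.map_smul c f
theorem Fn.mulc (M : Fn) (c : ℝ) (f : ℤ → ℝ) : M (fun n => f n * c) = M f * c := by
  have := M.cmul c f
  simp only [mul_comm c] at this
  exact this
theorem Fn.sum (M : Fn) {ι : Type} (s : Finset ι) (f : ι → ℤ → ℝ) :
    M (fun n => ∑ i ∈ s, f i n) = ∑ i ∈ s, M (f i) := by
  rw [← map_sum]; congr 1; ext n; simp

structure IsMean (M : Fn) : Prop where
  nonneg : ∀ f : ℤ → ℝ, Bdd f → (∀ n, 0 ≤ f n) → 0 ≤ M f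
  one : M (fun _ => 1) = 1
  shift : ∀ (f : ℤ → ℝ) (h : ℤ), Bdd f → M (fun n => f (n + h)) = M f
  tail : ∀ (f : ℤ → ℝ) (B : ℤ), Bdd f → (∀ n, B < n → f n = 0) → M f = 0

structure Dom (M G : Fn) : Prop where
  nonneg : ∀ f : ℤ → ℝ, Bdd f → (∀ n, 0 ≤ f n) → 0 ≤ G f
  le : ∀ f : ℤ → ℝ, Bdd f → (∀ n, 0 ≤ f n) → G f ≤ M f

section
variable {M G : Fn}

theorem IsMean.const (hM : IsMean M) (c : ℝ) : M (fun _ => c) = c := by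
  have := M.cmul c (fun _ => 1)
  rw [hM.one] at this
  simpa using this

theorem IsMean.dom (hM : IsMean M) : Dom M M := ⟨hM.nonneg, fun _ _ _ => le_rfl⟩

theorem Dom.mono (h : Dom M G) {f g : ℤ → ℝ} (hf : Bdd f) (hg : Bdd g) (hfg : ∀ n, f n ≤ g n) :
    G f ≤ G g := by
  have := h.nonneg (fun n => g n - f n) (bdd_sub hg hf) (fun n => sub_nonneg.2 (hfg n))
  rw [Fn.sub] at this
  linarith

theorem Dom.abs_le (h : Dom M G) {f : ℤ → ℝ} (hf : Bdd f) : |G f| ≤ M (fun n => |f n|) := by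
  have h0 := h.le (fun n => |f n|) (bdd_abs hf) (fun n => abs_nonneg _)
  have h1 := h.mono hf (bdd_abs hf) (fun n => le_abs_self _)
  have h2 := h.mono (bdd_neg hf) (bdd_abs hf) (fun n => neg_le_abs _)
  rw [Fn.neg] at h2
  rw [_root_.abs_le]
  constructor <;> linarith

theorem Dom.abs_le_const (h : Dom M G) (hM : IsMean M) {f : ℤ → ℝ} {c : ℝ} (hf : ∀ n, |f n| ≤ c) :
    |G f| ≤ c := by
  have hb : Bdd f := ⟨c, hf⟩
  refine (h.abs_le hb).trans ?_
  have := hM.dom.mono (bdd_abs hb) (bdd_const c) hf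
  rwa [hM.const] at this

theorem Dom.le_const (h : Dom M G) (hM : IsMean M) {f : ℤ → ℝ} {c : ℝ} (hf0 : ∀ n, 0 ≤ f n)
    (hf : ∀ n, f n ≤ c) : G f ≤ c :=
  (le_abs_self _).trans (h.abs_le_const hM (fun n => by rw [abs_of_nonneg (hf0 n)]; exact hf n))

theorem IsMean.le_const (hM : IsMean M) {f : ℤ → ℝ} {c : ℝ} (hb : Bdd f)
    (hf : ∀ n, f n ≤ c) : M f ≤ c := by
  have := hM.dom.mono hb (bdd_const c) hf
  rwa [hM.const] at this

theorem IsMean.const_le (hM : IsMean M) {f : ℤ → ℝ} {c : ℝ} (hb : Bdd f)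
    (hf : ∀ n, c ≤ f n) : c ≤ M f := by
  have := hM.dom.mono (bdd_const c) hb hf
  rwa [hM.const] at this

theorem Dom.bdd_inner (h : Dom M G) (hM : IsMean M) {X : Type} {F : X → ℤ → ℝ}
    (hF : Bdd (fun z : X × ℤ => F z.1 z.2)) : Bdd (fun b => G (F b)) := by
  obtain ⟨C, hC⟩ := hF
  exact ⟨C, fun b => h.abs_le_const hM (fun n => hC (b, n))⟩

theorem IsMean.cs (hM : IsMean M) {f g : ℤ → ℝ} (hf : Bdd f) (hg : Bdd g) :
    |M (fun n => f n * g n)| ≤ √(M (fun n => f n ^ 2)) * √(M (fun n => g n ^ 2)) := by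
  have key : ∀ t : ℝ, 0 ≤ M (fun n => f n ^ 2) * (t * t) + (2 * M (fun n => f n * g n)) * t
      + M (fun n => g n ^ 2) := by
    intro t
    have h := hM.nonneg (fun n => (t * f n + g n) ^ 2) (by fun_prop) (fun n => sq_nonneg _)
    have e : (fun n => (t * f n + g n) ^ 2) =
        (fun n => (t * t * f n ^ 2 + 2 * t * (f n * g n)) + g n ^ 2) := by
      ext n; ring
    rw [e, Fn.add, Fn.add, Fn.cmul, Fn.cmul] at h
    linarith
  have hd := discrim_le_zero key
  unfold discrim at hd
  rw [← Real.sqrt_mul (hM.nonneg (fun n => f n ^ 2) (bdd_pow hf 2) (fun n => sq_nonneg _))]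
  apply Real.abs_le_sqrt
  nlinarith

theorem IsMean.abs_le_sqrt (hM : IsMean M) {f : ℤ → ℝ} (hf : Bdd f) :
    M (fun n => |f n|) ≤ √(M (fun n => f n ^ 2)) := by
  have := hM.cs (bdd_abs hf) (bdd_const 1)
  simp only [mul_one, sq_abs, one_pow, hM.one, Real.sqrt_one] at this
  exact (le_abs_self _).trans this

theorem Dom.abs_le_sqrt (h : Dom M G) (hM : IsMean M) {f : ℤ → ℝ} (hf : Bdd f) :
    |G f| ≤ √(M (fun n => f n ^ 2)) := (h.abs_le hf).trans (hM.abs_le_sqrt hf)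

/-- Approximate Riesz representation. -/
theorem IsMean.ritz (hM : IsMean M) {C : ℝ} (hC : ∀ f, Bdd f → |G f| ≤ C * √(M (fun n => f n ^ 2)))
    {ε : ℝ} (hε : 0 < ε) : ∃ w, Bdd w ∧ ∀ f, Bdd f →
      |G f - M (fun n => f n * w n)| ≤ ε * √(M (fun n => f n ^ 2)) := by
  let Q : (ℤ → ℝ) → ℝ := fun w => 2 * G w - M (fun n => w n ^ 2)
  let S : Set ℝ := {x | ∃ w, Bdd w ∧ x = Q w}
  have hS : BddAbove S := by
    refine ⟨C ^ 2, ?_⟩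
    rintro x ⟨w, hw, rfl⟩
    have h1 := (le_abs_self _).trans (hC w hw)
    have h2 := Real.sq_sqrt (hM.nonneg (fun n => w n ^ 2) (by fun_prop) (fun n => sq_nonneg _))
    show 2 * G w - M (fun n => w n ^ 2) ≤ C ^ 2
    nlinarith [sq_nonneg (C - √(M (fun n => w n ^ 2)))]
  have hne : S.Nonempty := ⟨_, 0, bdd_const 0, rfl⟩
  obtain ⟨x, ⟨w, hw, rfl⟩, hx⟩ := exists_lt_of_lt_csSup hne (sub_lt_self (sSup S) (sq_pos_of_pos hε))
  refine ⟨w, hw, fun f hf => ?_⟩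
  have key : ∀ t : ℝ, 0 ≤ M (fun n => f n ^ 2) * (t * t) + (-2 * (G f - M (fun n => f n * w n))) * t
      + ε ^ 2 := by
    intro t
    have hb : Bdd (fun n => w n + t * f n) := by fun_prop
    have h := le_csSup hS ⟨_, hb, rfl⟩
    have e : (fun n => (w n + t * f n) ^ 2) =
        (fun n => (w n ^ 2 + (2 * t) * (f n * w n)) + t * t * f n ^ 2) := by
      ext n; ring
    have hq : Q (fun n => w n + t * f n) = 2 * (G w + t * G f) - (M (fun n => w n ^ 2)
      + (2 * t) * M (fun n => f n * w n) + t * t * M (fun n => f n ^ 2)) := by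
      show 2 * G (fun n => w n + t * f n) - M (fun n => (w n + t * f n) ^ 2) = _
      rw [e, Fn.add, Fn.add, Fn.add, Fn.cmul, Fn.cmul, Fn.cmul]
    rw [hq] at h
    have hx' : sSup S - ε ^ 2 < 2 * G w - M (fun n => w n ^ 2) := hx
    linarith
  have hd := discrim_le_zero key
  unfold discrim at hd
  have : ε * √(M (fun n => f n ^ 2)) = √(ε ^ 2 * M (fun n => f n ^ 2)) := by
    rw [Real.sqrt_mul (sq_nonneg _), Real.sqrt_sq hε.le]
  rw [this]
  apply Real.abs_le_sqrt
  nlinarith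

end

/-- Bohr almost periodic functions, via finite colourings. -/
def AP (a : ℤ → ℝ) : Prop :=
  ∀ ε : ℝ, 0 < ε → ∃ (K : Type) (_ : Finite K) (col : ℤ → K),
    ∀ c c', col c = col c' → ∀ t, |a (c + t) - a (c' + t)| ≤ ε

theorem AP.rep {a : ℤ → ℝ} (ha : AP a) {ε : ℝ} (hε : 0 < ε) :
    ∃ (K : Type) (_ : Fintype K) (col : ℤ → K) (r : K → ℤ),
      ∀ c t, |a (c + t) - a (r (col c) + t)| ≤ ε := by
  classical
  obtain ⟨K, hK, col, h⟩ := ha ε hε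
  have := Fintype.ofFinite K
  refine ⟨K, inferInstance, col, fun k => if hk : ∃ c, col c = k then hk.choose else 0, fun c t => ?_⟩
  apply h
  have hk : ∃ c', col c' = col c := ⟨c, rfl⟩
  simp only [hk, dif_pos]
  exact hk.choose_spec.symm

theorem AP.bdd {a : ℤ → ℝ} (ha : AP a) : Bdd a := by
  obtain ⟨K, _, col, r, h⟩ := ha.rep one_pos
  refine ⟨∑ k, |a (r k)| + 1, fun n => ?_⟩
  have h1 := h n 0
  simp only [add_zero] at h1
  have h2 : |a (r (col n))| ≤ ∑ k, |a (r k)| :=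
    Finset.single_le_sum (f := fun k => |a (r k)|) (fun k _ => abs_nonneg _) (Finset.mem_univ _)
  have h3 := abs_sub_abs_le_abs_sub (a n) (a (r (col n)))
  linarith

theorem AP.comp₂ {a b : ℤ → ℝ} (ha : AP a) (hb : AP b) (F : ℝ → ℝ → ℝ)
    (hF : ∀ C : ℝ, 0 < C → ∃ K : ℝ, 0 < K ∧ ∀ x y x' y', |x| ≤ C → |y| ≤ C → |x'| ≤ C → |y'| ≤ C →
      |F x y - F x' y'| ≤ K * (|x - x'| + |y - y'|)) : AP (fun n => F (a n) (b n)) := by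
  obtain ⟨C, hC, hCa⟩ := ha.bdd.pos
  obtain ⟨D, hD, hDb⟩ := hb.bdd.pos
  obtain ⟨K, hK, hFK⟩ := hF (max C D) (by positivity)
  intro ε hε
  obtain ⟨K1, _, c1, h1⟩ := ha (ε / (2 * K)) (by positivity)
  obtain ⟨K2, _, c2, h2⟩ := hb (ε / (2 * K)) (by positivity)
  refine ⟨K1 × K2, inferInstance, fun n => (c1 n, c2 n), fun c c' hcc t => ?_⟩
  simp only [Prod.mk.injEq] at hcc
  have e1 := h1 c c' hcc.1 t
  have e2 := h2 c c' hcc.2 t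
  have hA : ∀ n, |a n| ≤ max C D := fun n => (hCa n).trans (le_max_left _ _)
  have hB : ∀ n, |b n| ≤ max C D := fun n => (hDb n).trans (le_max_right _ _)
  refine (hFK _ _ _ _ (hA _) (hB _) (hA _) (hB _)).trans ?_
  calc K * _ ≤ K * (ε / (2 * K) + ε / (2 * K)) := by gcongr
    _ = ε := by field_simp; ring

theorem AP.const (c : ℝ) : AP (fun _ => c) := fun ε hε =>
  ⟨Unit, inferInstance, fun _ => (), fun _ _ _ _ => by simpa using hε.le⟩

theorem AP.add {a b : ℤ → ℝ} (ha : AP a) (hb : AP b) : AP (fun n => a n + b n) :=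
  ha.comp₂ hb (fun x y => x + y) (fun C _ => ⟨1, one_pos, fun x y x' y' _ _ _ _ => by
    rw [one_mul, show x + y - (x' + y') = (x - x') + (y - y') by ring]; exact abs_add_le _ _⟩)

theorem AP.mul {a b : ℤ → ℝ} (ha : AP a) (hb : AP b) : AP (fun n => a n * b n) :=
  ha.comp₂ hb (fun x y => x * y) (fun C hC => ⟨C, hC, fun x y x' y' hx hy hx' hy' => by
    rw [show x * y - x' * y' = (x - x') * y + x' * (y - y') by ring]
    refine (abs_add_le _ _).trans ?_
    rw [abs_mul, abs_mul, mul_add]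
    have := mul_le_mul_of_nonneg_left hy (abs_nonneg (x - x'))
    have := mul_le_mul_of_nonneg_right hx' (abs_nonneg (y - y'))
    linarith⟩)

theorem AP.cmul {a : ℤ → ℝ} (ha : AP a) (c : ℝ) : AP (fun n => c * a n) := (AP.const c).mul ha

theorem AP.max {a b : ℤ → ℝ} (ha : AP a) (hb : AP b) : AP (fun n => max (a n) (b n)) :=
  ha.comp₂ hb (fun x y => Max.max x y) (fun C _ => ⟨1, one_pos, fun x y x' y' _ _ _ _ => by
    rw [one_mul]
    refine (abs_max_sub_max_le_max _ _ _ _).trans ?_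
    exact max_le (le_add_of_nonneg_right (abs_nonneg _)) (le_add_of_nonneg_left (abs_nonneg _))⟩)

theorem AP.neg {a : ℤ → ℝ} (ha : AP a) : AP (fun n => - a n) := by
  simpa using ha.cmul (-1)

theorem AP.min {a b : ℤ → ℝ} (ha : AP a) (hb : AP b) : AP (fun n => min (a n) (b n)) := by
  have := (ha.neg.max hb.neg).neg
  simpa [max_neg_neg] using this

theorem AP.sub {a b : ℤ → ℝ} (ha : AP a) (hb : AP b) : AP (fun n => a n - b n) := by
  simpa [sub_eq_add_neg] using ha.add hb.neg

theorem AP.trans {a : ℤ → ℝ} (ha : AP a) (h : ℤ) : AP (fun n => a (n + h)) := by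
  intro ε hε
  obtain ⟨K, hK, col, H⟩ := ha ε hε
  refine ⟨K, hK, col, fun c c' hc t => ?_⟩
  have := H c c' hc (t + h)
  simpa [add_assoc] using this

theorem sum_shift_bound {a : ℤ → ℝ} {C : ℝ} (hC : ∀ n, |a n| ≤ C) (L k : ℕ) (c : ℤ) :
    |∑ t ∈ Finset.range L, a (c + k + t) - ∑ t ∈ Finset.range L, a (c + t)| ≤ 2 * k * C := by
  induction k with
  | zero => simp
  | succ k ih =>
    have e : ∑ t ∈ Finset.range L, a (c + (k + 1 : ℕ) + t) =
        ∑ t ∈ Finset.range L, a (c + k + t) + a (c + k + L) - a (c + k) := by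
      have h1 := Finset.sum_range_succ (fun t : ℕ => a (c + k + t)) L
      have h2 := Finset.sum_range_succ' (fun t : ℕ => a (c + k + t)) L
      rw [h1] at h2
      have h3 : ∀ t : ℕ, a (c + (k + 1 : ℕ) + t) = a (c + k + (t + 1 : ℕ)) := by
        intro t; congr 1; push_cast; ring
      simp only [h3]
      simp only [Nat.cast_zero, add_zero] at h2
      linarith
    rw [e]
    have h1 := hC (c + k + L)
    have h2 := hC (c + k)
    rw [abs_le] at *
    push_cast
    constructor <;> nlinarith

/-- uniform mean of almost periodic functions -/
theorem AP.unif {M : Fn} (hM : IsMean M) {a : ℤ → ℝ} (ha : AP a) {ε : ℝ} (hε : 0 < ε) :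
    ∃ L0 : ℕ, ∀ L : ℕ, L0 ≤ L → ∀ c : ℤ,
      |∑ t ∈ Finset.range L, a (c + t) - L * M a| ≤ ε * L := by
  obtain ⟨K, _, col, r, h⟩ := ha.rep (half_pos hε)
  obtain ⟨C, hC, hCa⟩ := ha.bdd.pos
  let R : ℕ := ∑ k, (r k).natAbs
  have hR : ∀ k, (r k).natAbs ≤ R := fun k =>
    Finset.single_le_sum (f := fun k => (r k).natAbs) (fun k _ => Nat.zero_le _) (Finset.mem_univ _)
  obtain ⟨L0, hL0⟩ := exists_nat_ge (2 * (2 * R : ℕ) * C / (ε / 2))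
  refine ⟨L0, fun L hL c => ?_⟩
  have key : ∀ c c' : ℤ, |∑ t ∈ Finset.range L, a (c + t) - ∑ t ∈ Finset.range L, a (c' + t)|
      ≤ ε * L := by
    intro c c'
    let y : ℤ := c' - c - R
    let t0 : ℕ := (r (col y) + R).toNat
    have ht0 : (t0 : ℤ) = r (col y) + R := by
      have := hR (col y)
      apply Int.toNat_of_nonneg
      omega
    have ht1 : t0 ≤ 2 * R := by
      have := hR (col y)
      omega
    have h1 := sum_shift_bound hCa L t0 c
    have h2 : |∑ t ∈ Finset.range L, a (c' + t) - ∑ t ∈ Finset.range L, a (c + t0 + t)|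
        ≤ ε / 2 * L := by
      rw [← Finset.sum_sub_distrib]
      refine (Finset.abs_sum_le_sum_abs _ _).trans ?_
      have : ∀ t ∈ Finset.range L, |a (c' + t) - a (c + t0 + t)| ≤ ε / 2 := by
        intro t _
        have := h y (c' - y + t)
        have e1 : y + (c' - y + t) = c' + t := by ring
        have e2 : r (col y) + (c' - y + t) = c + t0 + t := by
          rw [ht0]; simp only [y]; ring
        rwa [e1, e2] at this
      refine (Finset.sum_le_sum this).trans ?_
      simp [mul_comm]
    have h3 : 2 * (t0 : ℝ) * C ≤ ε / 2 * L := by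
      have hLR : (L0 : ℝ) ≤ L := by exact_mod_cast hL
      have h4 : 2 * ((2 * R : ℕ) : ℝ) * C ≤ ε / 2 * L := by
        have := hL0.trans hLR
        rw [div_le_iff₀ (by positivity)] at this
        linarith
      have h5 : (t0 : ℝ) ≤ ((2 * R : ℕ) : ℝ) := by exact_mod_cast ht1
      nlinarith
    rw [abs_le] at *
    constructor <;> linarith
  have hS : M (fun c' => ∑ t ∈ Finset.range L, a (c' + t)) = L * M a := by
    rw [Fn.sum]
    have e : ∀ t ∈ Finset.range L, M (fun c' => a (c' + (t : ℤ))) = M a :=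
      fun t _ => hM.shift a t ha.bdd
    rw [Finset.sum_congr rfl e]
    simp
  have h2 := hM.dom.abs_le_const hM (fun c' => key c c')
  rwa [Fn.sub, hM.const, hS] at h2

end MBLB


namespace MBLB

section HS
variable {M : Fn}

/-- Orthonormality of the first `r` functions. -/
def ON (M : Fn) (r : ℕ) (w : ℕ → ℤ → ℝ) : Prop :=
  (∀ i, Bdd (w i)) ∧ ∀ i < r, ∀ j < r, M (fun n => w i n * w j n) = if i = j then 1 else 0

theorem ON.orth {r : ℕ} {w : ℕ → ℤ → ℝ} (h : ON M r w) (f : ℤ → ℝ)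
    {j : ℕ} (hj : j < r) :
    M (fun n => (f n - ∑ i ∈ Finset.range r, M (fun n => f n * w i n) * w i n) * w j n) = 0 := by
  have e : (fun n => (f n - ∑ i ∈ Finset.range r, M (fun n => f n * w i n) * w i n) * w j n) =
      fun n => f n * w j n - ∑ i ∈ Finset.range r, M (fun n => f n * w i n) * (w i n * w j n) := by
    ext n; rw [sub_mul, Finset.sum_mul]; simp only [mul_assoc]
  rw [e, Fn.sub, Fn.sum]
  have e2 : ∀ i ∈ Finset.range r, M (fun n => M (fun n => f n * w i n) * (w i n * w j n)) =
      if i = j then M (fun n => f n * w i n) else 0 := by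
    intro i hi
    rw [Fn.cmul, h.2 i (Finset.mem_range.1 hi) j hj]
    split_ifs <;> simp
  rw [Finset.sum_congr rfl e2]
  simp [hj]

theorem ON.bessel {r : ℕ} {w : ℕ → ℤ → ℝ} (h : ON M r w) (f : ℤ → ℝ) :
    M (fun n => (f n - ∑ i ∈ Finset.range r, M (fun n => f n * w i n) * w i n) ^ 2) =
      M (fun n => f n ^ 2) - ∑ i ∈ Finset.range r, M (fun n => f n * w i n) ^ 2 := by
  set v : ℤ → ℝ := fun n => f n - ∑ i ∈ Finset.range r, M (fun n => f n * w i n) * w i n with hv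
  have e : (fun n => v n ^ 2) = fun n => (f n ^ 2 -
      ∑ i ∈ Finset.range r, M (fun n => f n * w i n) * (f n * w i n))
      - ∑ i ∈ Finset.range r, M (fun n => f n * w i n) * (v n * w i n) := by
    ext n
    have h1 : ∑ i ∈ Finset.range r, M (fun n => f n * w i n) * (f n * w i n) =
        f n * ∑ i ∈ Finset.range r, M (fun n => f n * w i n) * w i n := by
      rw [Finset.mul_sum]; apply Finset.sum_congr rfl; intros; ring
    have h2 : ∑ i ∈ Finset.range r, M (fun n => f n * w i n) * (v n * w i n) =
        v n * ∑ i ∈ Finset.range r, M (fun n => f n * w i n) * w i n := by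
      rw [Finset.mul_sum]; apply Finset.sum_congr rfl; intros; ring
    rw [h1, h2]
    simp only [hv]
    ring
  rw [e, Fn.sub, Fn.sub, Fn.sum, Fn.sum]
  have e1 : ∀ i ∈ Finset.range r, M (fun n => M (fun n => f n * w i n) * (f n * w i n)) =
      M (fun n => f n * w i n) ^ 2 := by
    intro i _; rw [Fn.cmul, sq]
  have e2 : ∀ i ∈ Finset.range r, M (fun n => M (fun n => f n * w i n) * (v n * w i n)) = 0 := by
    intro i hi; rw [Fn.cmul, h.orth f (Finset.mem_range.1 hi), mul_zero]
  rw [Finset.sum_congr rfl e1, Finset.sum_congr rfl e2]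
  simp

theorem ON.bessel_le (hM : IsMean M) {r : ℕ} {w : ℕ → ℤ → ℝ} (h : ON M r w) {f : ℤ → ℝ}
    (hf : Bdd f) : ∑ i ∈ Finset.range r, M (fun n => f n * w i n) ^ 2 ≤ M (fun n => f n ^ 2) := by
  have h1 := h.bessel f
  have hw := h.1
  have h2 := hM.nonneg (fun n => (f n - ∑ i ∈ Finset.range r,
    M (fun n => f n * w i n) * w i n) ^ 2) (by fun_prop) (fun n => sq_nonneg _)
  linarith

variable {F : ℤ → ℤ → ℝ}

theorem hs_lemma (hM : IsMean M) (hF0 : ∀ b n, 0 ≤ F b n) (hF1 : ∀ b n, F b n ≤ 1)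
    {ε : ℝ} (hε : 0 < ε) : ∃ r w, ON M r w ∧ ∀ v, Bdd v →
      (∀ i < r, M (fun n => v n * w i n) = 0) →
      M (fun b => M (fun n => F b n * v n) ^ 2) ≤ ε * M (fun n => v n ^ 2) := by
  by_contra hcon
  push Not at hcon
  have hFb : Bdd (fun z : ℤ × ℤ => F z.1 z.2) :=
    ⟨1, fun z => by rw [abs_of_nonneg (hF0 _ _)]; exact hF1 _ _⟩
  have hFb1 : ∀ b, Bdd (fun n => F b n) := fun b => hFb.comp (fun n => (b, n))
  have hin : ∀ v, Bdd v → Bdd (fun b => M (fun n => F b n * v n)) := fun v hv =>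
    hM.dom.bdd_inner hM (F := fun b n => F b n * v n) (by fun_prop)
  have build : ∀ r, ∃ w, ON M r w ∧ ∀ i < r, ε ≤ M (fun b => M (fun n => F b n * w i n) ^ 2) := by
    intro r
    induction r with
    | zero => exact ⟨fun _ _ => 0, ⟨fun _ => bdd_const 0, by simp⟩, by simp⟩
    | succ r ih =>
      obtain ⟨w, hw, hwε⟩ := ih
      obtain ⟨v, hv, hvo, hvb⟩ := hcon r w hw
      have hw1 := hw.1
      have hq0 : 0 ≤ M (fun n => v n ^ 2) := hM.nonneg _ (by fun_prop) (fun n => sq_nonneg _)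
      have hq : 0 < M (fun n => v n ^ 2) := by
        rcases hq0.eq_or_lt with h0 | h0
        · exfalso
          have : ∀ b, M (fun n => F b n * v n) = 0 := by
            intro b
            have := hM.cs (hFb1 b) hv
            rw [← h0] at this
            simpa using this
          simp only [this, ← h0] at hvb
          simp [hM.const] at hvb
        · exact h0
      set s := √(M (fun n => v n ^ 2)) with hs
      have hs0 : 0 < s := Real.sqrt_pos.2 hq
      have hs2 : s ^ 2 = M (fun n => v n ^ 2) := Real.sq_sqrt hq0
      let u : ℤ → ℝ := fun n => s⁻¹ * v n
      have hu : Bdd u := by fun_prop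
      have hui : ∀ f : ℤ → ℝ, M (fun n => f n * u n) = s⁻¹ * M (fun n => f n * v n) := by
        intro f
        rw [← Fn.cmul]; congr 1; ext n; simp only [u]; ring
      have huo : ∀ i < r, M (fun n => w i n * u n) = 0 := by
        intro i hi
        rw [hui]
        have : M (fun n => w i n * v n) = 0 := by
          rw [← hvo i hi]; congr 1; ext n; ring
        rw [this, mul_zero]
      have huu : M (fun n => u n * u n) = 1 := by
        rw [hui]
        have : M (fun n => u n * v n) = s⁻¹ * s ^ 2 := by
          rw [hs2, ← Fn.cmul]; congr 1; ext n; simp only [u]; ring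
        rw [this]; field_simp
      refine ⟨Function.update w r u, ⟨?_, ?_⟩, ?_⟩
      · intro i
        by_cases hi : i = r
        · subst hi; simpa using hu
        · simpa [hi] using hw1 i
      · intro i hi j hj
        by_cases h1 : i = r <;> by_cases h2 : j = r
        · subst h1; subst h2; simpa using huu
        · subst h1
          have := huo j (by omega)
          simp only [Function.update_self, ne_eq, h2, not_false_eq_true, Function.update_of_ne,
            Ne.symm h2, if_false]
          rw [← this]; congr 1; ext n; ring
        · subst h2
          have := huo i (by omega)
          simpa [h1] using this
        · simp only [ne_eq, h2, h1, not_false_eq_true, Function.update_of_ne]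
          exact hw.2 i (by omega) j (by omega)
      · intro i hi
        by_cases h1 : i = r
        · subst h1
          simp only [Function.update_self, hui]
          have : M (fun b => (s⁻¹ * M (fun n => F b n * v n)) ^ 2) =
              (s⁻¹) ^ 2 * M (fun b => M (fun n => F b n * v n) ^ 2) := by
            rw [← Fn.cmul]; congr 1; ext b; ring
          rw [this]
          rw [← hs2] at hvb
          calc ε = (s⁻¹) ^ 2 * (ε * s ^ 2) := by field_simp
            _ ≤ _ := by gcongr
        · simpa [h1] using hwε i (by omega)
  obtain ⟨r, hr⟩ := exists_nat_gt (1 / ε)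
  obtain ⟨w, hw, hwε⟩ := build r
  have hw1 := hw.1
  have h1 : M (fun b => ∑ i ∈ Finset.range r, M (fun n => F b n * w i n) ^ 2) ≤ 1 := by
    apply hM.le_const
    · apply bdd_sum
      intro i
      exact bdd_pow (hin _ (hw1 i)) 2
    · intro b
      refine (hw.bessel_le hM (hFb1 b)).trans ?_
      apply hM.le_const (by have := hFb1 b; fun_prop)
      intro n
      exact pow_le_one₀ (hF0 _ _) (hF1 _ _)
  rw [Fn.sum] at h1
  have h2 : (r : ℝ) * ε ≤ 1 := by
    refine le_trans ?_ h1
    have := Finset.card_nsmul_le_sum (Finset.range r)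
      (fun i => M (fun b => M (fun n => F b n * w i n) ^ 2)) ε
      (fun i hi => hwε i (Finset.mem_range.1 hi))
    simpa using this
  rw [div_lt_iff₀ hε] at hr
  linarith

/-- total boundedness of the correlation metric -/
theorem corr_col (hM : IsMean M) (hF0 : ∀ b n, 0 ≤ F b n) (hF1 : ∀ b n, F b n ≤ 1)
    {ε : ℝ} (hε : 0 < ε) : ∃ (K : Type) (_ : Finite K) (col : ℤ → K), ∀ c c', col c = col c' →
      M (fun b => |M (fun n => F b n * F c n) - M (fun n => F b n * F c' n)|) ≤ ε := by
  obtain ⟨r, w, hw, H⟩ := hs_lemma hM hF0 hF1 (ε := (ε / 2) ^ 2) (by positivity)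
  have hFb : Bdd (fun z : ℤ × ℤ => F z.1 z.2) :=
    ⟨1, fun z => by rw [abs_of_nonneg (hF0 _ _)]; exact hF1 _ _⟩
  have hFb1 : ∀ b, Bdd (fun n => F b n) := fun b => hFb.comp (fun n => (b, n))
  have hin : ∀ v, Bdd v → Bdd (fun b => M (fun n => F b n * v n)) := fun v hv =>
    hM.dom.bdd_inner hM (F := fun b n => F b n * v n) (by fun_prop)
  have hw1 := hw.1
  set δ : ℝ := ε / (2 * (r + 1)) with hδ
  have hδ0 : 0 < δ := by positivity
  have hFsq : ∀ b, M (fun n => F b n ^ 2) ≤ 1 := fun b => by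
    apply hM.le_const (by have := hFb1 b; fun_prop)
    intro n
    exact pow_le_one₀ (hF0 _ _) (hF1 _ _)
  have hcoef : ∀ b, ∀ i < r, |M (fun n => F b n * w i n)| ≤ 1 := by
    intro b i hi
    refine (hM.cs (hFb1 b) (hw1 i)).trans ?_
    have : M (fun n => w i n ^ 2) = 1 := by
      have := hw.2 i hi i hi
      simpa [sq] using this
    rw [this, Real.sqrt_one, mul_one]
    exact Real.sqrt_le_one.2 (hFsq b)
  let N : ℤ := ⌈1 / δ⌉ + 1
  have hfl : ∀ c, ∀ i < r, ⌊M (fun n => F c n * w i n) / δ⌋ ∈ Set.Icc (-N) N := by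
    intro c i hi
    have h := abs_le.1 (hcoef c i hi)
    have h1 : 1 / δ ≤ ⌈1 / δ⌉ := Int.le_ceil _
    constructor
    · rw [Int.le_floor]
      simp only [N]; push_cast
      have : -(1 / δ) ≤ M (fun n => F c n * w i n) / δ := by
        rw [← neg_div]; gcongr; exact h.1
      linarith
    · have h2 : (⌊M (fun n => F c n * w i n) / δ⌋ : ℝ) ≤ M (fun n => F c n * w i n) / δ :=
        Int.floor_le _
      have : M (fun n => F c n * w i n) / δ ≤ 1 / δ := by
        gcongr; exact h.2
      have : (⌊M (fun n => F c n * w i n) / δ⌋ : ℝ) ≤ (N : ℝ) := by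
        simp only [N]; push_cast; linarith
      exact_mod_cast this
  refine ⟨Fin r → Set.Icc (-N) N, inferInstance, fun c i => ⟨_, hfl c i i.2⟩, fun c c' hcc => ?_⟩
  let f : ℤ → ℝ := fun n => F c n - F c' n
  have hf : Bdd f := bdd_sub (hFb1 c) (hFb1 c')
  have hfi : ∀ g : ℤ → ℝ, M (fun n => f n * g n) = M (fun n => F c n * g n)
      - M (fun n => F c' n * g n) := by
    intro g; rw [← Fn.sub]; congr 1; ext n; simp only [f]; ring
  have hfw : ∀ i < r, |M (fun n => f n * w i n)| ≤ δ := by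
    intro i hi
    have h1 := congrFun hcc ⟨i, hi⟩
    simp only [Subtype.mk.injEq] at h1
    have h2 := Int.abs_sub_lt_one_of_floor_eq_floor h1
    rw [← sub_div, abs_div, abs_of_pos hδ0, div_lt_one hδ0] at h2
    rw [hfi]; exact h2.le
  let v : ℤ → ℝ := fun n => f n - ∑ i ∈ Finset.range r, M (fun n => f n * w i n) * w i n
  have hv : Bdd v := by fun_prop
  have hv2 : M (fun n => v n ^ 2) ≤ 1 := by
    have h1 := hw.bessel f
    have h2 : 0 ≤ ∑ i ∈ Finset.range r, M (fun n => f n * w i n) ^ 2 :=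
      Finset.sum_nonneg (fun i _ => sq_nonneg _)
    have h3 : M (fun n => f n ^ 2) ≤ 1 := by
      apply hM.le_const (by fun_prop)
      intro n
      have := hF0 c n
      have := hF0 c' n
      have := hF1 c n
      have := hF1 c' n
      simp only [f]
      nlinarith
    show M (fun n => (f n - ∑ i ∈ Finset.range r, M (fun n => f n * w i n) * w i n) ^ 2) ≤ 1
    linarith
  have hHv := H v hv (fun i hi => hw.orth f hi)
  have h1 : M (fun b => |M (fun n => F b n * v n)|) ≤ ε / 2 := by
    refine (hM.abs_le_sqrt (hin v hv)).trans ?_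
    rw [Real.sqrt_le_left (by positivity)]
    refine hHv.trans ?_
    exact mul_le_of_le_one_right (by positivity) hv2
  have h2 : ∀ b, |M (fun n => F b n * F c n) - M (fun n => F b n * F c' n)| ≤
      |M (fun n => F b n * v n)| + ε / 2 := by
    intro b
    have e : M (fun n => F b n * F c n) - M (fun n => F b n * F c' n) = M (fun n => F b n * v n)
        + ∑ i ∈ Finset.range r, M (fun n => f n * w i n) * M (fun n => F b n * w i n) := by
      have : ∀ i ∈ Finset.range r, M (fun n => f n * w i n) * M (fun n => F b n * w i n) =
        M (fun n => M (fun n => f n * w i n) * (F b n * w i n)) := fun i _ => by rw [Fn.cmul]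
      rw [Finset.sum_congr rfl this, ← Fn.sum, ← Fn.sub, ← Fn.add]
      congr 1; ext n
      have e2 : ∑ i ∈ Finset.range r, M (fun n => f n * w i n) * (F b n * w i n) =
        F b n * ∑ i ∈ Finset.range r, M (fun n => f n * w i n) * w i n := by
        rw [Finset.mul_sum]; apply Finset.sum_congr rfl; intros; ring
      rw [e2]
      simp only [v, f]; ring
    rw [e]
    refine (abs_add_le _ _).trans ?_
    gcongr
    refine (Finset.abs_sum_le_sum_abs _ _).trans ?_
    have : ∀ i ∈ Finset.range r, |M (fun n => f n * w i n) * M (fun n => F b n * w i n)| ≤ δ := by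
      intro i hi
      have hi := Finset.mem_range.1 hi
      rw [abs_mul]
      calc _ ≤ δ * 1 := mul_le_mul (hfw i hi) (hcoef b i hi) (abs_nonneg _) hδ0.le
        _ = δ := mul_one _
    refine (Finset.sum_le_sum this).trans ?_
    simp only [Finset.sum_const, Finset.card_range, nsmul_eq_mul, hδ]
    rw [← mul_div_assoc, div_le_div_iff₀ (by positivity) (by positivity)]
    nlinarith
  have hb1 := hin v hv
  have hb2 := hin _ (hFb1 c)
  have hb3 := hin _ (hFb1 c')
  have h3 := hM.dom.mono (f := fun b => |M (fun n => F b n * F c n) - M (fun n => F b n * F c' n)|)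
    (g := fun b => |M (fun n => F b n * v n)| + ε / 2) (bdd_abs (bdd_sub hb2 hb3))
    (bdd_add (bdd_abs hb1) (bdd_const _)) h2
  rw [Fn.add, hM.const] at h3
  linarith

/-- the averaged correlation is almost periodic -/
theorem theta_ap (hM : IsMean M) (hF0 : ∀ b n, 0 ≤ F b n) (hF1 : ∀ b n, F b n ≤ 1)
    {l k : ℤ} (hl : 0 < l) (hFs : ∀ b n, F (b + l) n = F b (n + k))
    {f : ℤ → ℝ} {C : ℝ} (hC : 0 < C) (hf : ∀ b, |f b| ≤ C) :
    AP (fun c => M (fun b => f b * M (fun n => F b n * F c n))) := by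
  have hfb : Bdd f := ⟨C, hf⟩
  have hFb : Bdd (fun z : ℤ × ℤ => F z.1 z.2) :=
    ⟨1, fun z => by rw [abs_of_nonneg (hF0 _ _)]; exact hF1 _ _⟩
  have hFb1 : ∀ b, Bdd (fun n => F b n) := fun b => hFb.comp (fun n => (b, n))
  have hin : ∀ v, Bdd v → Bdd (fun b => M (fun n => F b n * v n)) := fun v hv =>
    hM.dom.bdd_inner hM (F := fun b n => F b n * v n) (by fun_prop)
  have hFs' : ∀ (j : ℤ) b n, F (b + l * j) n = F b (n + k * j) := by
    have hn : ∀ (j : ℕ) b n, F (b + l * j) n = F b (n + k * j) := by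
      intro j
      induction j with
      | zero => simp
      | succ j ih =>
        intro b n
        have : b + l * ((j + 1 : ℕ) : ℤ) = (b + l * j) + l := by push_cast; ring
        rw [this, hFs, ih]
        congr 1; push_cast; ring
    intro j b n
    obtain ⟨j, rfl | rfl⟩ := Int.eq_nat_or_neg j
    · exact hn j b n
    · have := hn j (b + l * (-(j : ℤ))) (n + k * (-(j : ℤ)))
      have e1 : b + l * (-(j : ℤ)) + l * (j : ℤ) = b := by ring
      have e2 : n + k * (-(j : ℤ)) + k * (j : ℤ) = n := by ring
      rw [e1, e2] at this
      exact this.symm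
  intro ε hε
  obtain ⟨K, hK, col, H⟩ := corr_col hM hF0 hF1 (ε := ε / C) (by positivity)
  refine ⟨Fin l.toNat → K, inferInstance, fun c i => col (c + (i : ℕ)), fun c c' hcc t => ?_⟩
  have hD : ∀ c c', |M (fun b => f b * M (fun n => F b n * F c n))
      - M (fun b => f b * M (fun n => F b n * F c' n))| ≤
      C * M (fun b => |M (fun n => F b n * F c n) - M (fun n => F b n * F c' n)|) := by
    intro c c'
    have hb2 := hin _ (hFb1 c)
    have hb3 := hin _ (hFb1 c')
    rw [← Fn.sub, ← Fn.cmul]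
    have hb4 := bdd_sub (bdd_mul hfb hb2) (bdd_mul hfb hb3)
    refine (hM.dom.abs_le hb4).trans ?_
    apply hM.dom.mono (bdd_abs hb4) (bdd_mul (bdd_const C) (bdd_abs (bdd_sub hb2 hb3)))
    intro b
    rw [← mul_sub, abs_mul]
    gcongr
    exact hf b
  refine (hD _ _).trans ?_
  have hmod : 0 ≤ t % l := Int.emod_nonneg _ hl.ne'
  have hmod2 : t % l < l := Int.emod_lt_of_pos _ hl
  have hc := congrFun hcc ⟨(t % l).toNat, by omega⟩
  have htn : (((t % l).toNat : ℕ) : ℤ) = t % l := Int.toNat_of_nonneg hmod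
  simp only [htn] at hc
  have h1 := H _ _ hc
  have hdm : t = t % l + l * (t / l) := (Int.emod_add_mul_ediv t l).symm
  -- shift invariance
  have hinv : ∀ (j : ℤ) b c, M (fun n => F (b + l * j) n * F (c + l * j) n) =
      M (fun n => F b n * F c n) := by
    intro j b c
    simp only [hFs']
    have := hFb1 b
    have := hFb1 c
    exact hM.shift (fun n => F b n * F c n) (k * j) (by fun_prop)
  have h2 : M (fun b => |M (fun n => F b n * F (c + t) n) - M (fun n => F b n * F (c' + t) n)|) =
      M (fun b => |M (fun n => F b n * F (c + t % l) n) - M (fun n => F b n * F (c' + t % l) n)|) := by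
    have hb2 := hin _ (hFb1 (c + t))
    have hb3 := hin _ (hFb1 (c' + t))
    rw [← hM.shift _ (l * (t / l)) (bdd_abs (bdd_sub hb2 hb3))]
    congr 1; ext b
    have e1 : c + t = (c + t % l) + l * (t / l) := by rw [add_assoc, ← hdm]
    have e2 : c' + t = (c' + t % l) + l * (t / l) := by rw [add_assoc, ← hdm]
    rw [e1, e2, hinv, hinv]
  rw [h2]
  calc _ ≤ C * (ε / C) := by gcongr
    _ = ε := by field_simp

end HS
end MBLB


namespace MBLB

section W
variable {M : Fn} {F : ℤ → ℤ → ℝ}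

/-- multiply the argument of a functional -/
def Fn.mulBy (G : Fn) (v : ℤ → ℝ) : Fn where
  toFun w := G (fun n => v n * w n)
  map_add' x y := by
    rw [← Fn.add]; congr 1; ext n; simp [mul_add]
  map_smul' c x := by
    simp only [RingHom.id_apply, smul_eq_mul]
    rw [← Fn.cmul]; congr 1; ext n; simp [mul_left_comm]

/-- composed functional -/
def Fn.dbl (M G : Fn) (f : ℤ → ℝ) (F : ℤ → ℤ → ℝ) : Fn where
  toFun w := M (fun b => f b * G (fun n => F b n * w n))
  map_add' x y := by
    rw [← Fn.add]; congr 1; ext b; rw [← mul_add, ← Fn.add]; congr 2; ext n; simp [mul_add]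
  map_smul' c x := by
    simp only [RingHom.id_apply, smul_eq_mul]
    rw [← Fn.cmul]; congr 1; ext b; rw [mul_left_comm, ← Fn.cmul G c]; congr 2; ext n
    simp [mul_left_comm]

theorem lemmaW (hM : IsMean M) (hF0 : ∀ b n, 0 ≤ F b n) (hF1 : ∀ b n, F b n ≤ 1)
    {l k : ℤ} (hl : 0 < l) (hFs : ∀ b n, F (b + l) n = F b (n + k))
    {C δ : ℝ} (hC : 0 < C) (hδ : 0 < δ) : ∃ e : ℝ, 0 < e ∧ ∀ f : ℤ → ℝ, (∀ b, |f b| ≤ C) →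
      (∀ a, AP a → ∀ D, (∀ n, |a n| ≤ D) → |M (fun n => f n * a n)| ≤ e * D) →
      ∀ G : Fn, (∀ w, Bdd w → |G w| ≤ √(M (fun n => w n ^ 2))) →
      |M (fun b => f b * G (fun n => F b n))| ≤ δ := by
  refine ⟨δ ^ 2 / (96 * C), by positivity, fun f hf hfa G hG => ?_⟩
  have hfb : Bdd f := ⟨C, hf⟩
  have hFb : Bdd (fun z : ℤ × ℤ => F z.1 z.2) :=
    ⟨1, fun z => by rw [abs_of_nonneg (hF0 _ _)]; exact hF1 _ _⟩
  have hFb1 : ∀ b, Bdd (fun n => F b n) := fun b => hFb.comp (fun n => (b, n))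
  have hin : ∀ v, Bdd v → Bdd (fun b => M (fun n => F b n * v n)) := fun v hv =>
    hM.dom.bdd_inner hM (F := fun b n => F b n * v n) (by fun_prop)
  have hFsq : ∀ b, √(M (fun n => F b n ^ 2)) ≤ 1 := fun b => by
    apply Real.sqrt_le_one.2
    apply hM.le_const (by have := hFb1 b; fun_prop)
    intro n
    exact pow_le_one₀ (hF0 _ _) (hF1 _ _)
  have hGF : Bdd (fun b => G (fun n => F b n)) := ⟨1, fun b => (hG _ (hFb1 b)).trans (hFsq b)⟩
  -- comparing averages
  have hcmp : ∀ (x y : ℤ → ℝ) (ε : ℝ), 0 ≤ ε → Bdd x → Bdd y → (∀ b, |x b - y b| ≤ ε) →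
      |M (fun b => f b * x b) - M (fun b => f b * y b)| ≤ C * ε := by
    intro x y ε hε hx hy hxy
    rw [← Fn.sub]
    apply hM.dom.abs_le_const hM
    intro b
    rw [← mul_sub, abs_mul]
    exact mul_le_mul (hf b) (hxy b) (abs_nonneg _) hC.le
  set ε1 : ℝ := min 1 (δ / (4 * C)) with hε1
  have hε10 : 0 < ε1 := by positivity
  set ε2 : ℝ := min (δ / 8) (δ ^ 2 / (96 * C)) with hε2
  have hε20 : 0 < ε2 := by positivity
  obtain ⟨u, hu, hGu⟩ := hM.ritz (G := G) (C := 1) (fun f hf => by simpa using hG f hf) hε10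
  have hu2 : √(M (fun n => u n ^ 2)) ≤ 2 := by
    have h1 := hGu u hu
    have h2 := hG u hu
    have h3 := Real.sq_sqrt (hM.nonneg (fun n => u n ^ 2) (by fun_prop) (fun n => sq_nonneg _))
    have h4 : M (fun n => u n * u n) = M (fun n => u n ^ 2) := by simp only [sq]
    rw [h4] at h1
    set s := √(M (fun n => u n ^ 2))
    have h5 : ε1 ≤ 1 := min_le_left _ _
    have h6 : 0 ≤ s := Real.sqrt_nonneg _
    rw [abs_le] at h1 h2
    by_contra hs
    nlinarith
  let T : Fn := M.dbl M f F
  have hT : ∀ w, T w = M (fun b => f b * M (fun n => F b n * w n)) := fun w => rfl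
  have hTb : ∀ w, Bdd w → |T w| ≤ C * √(M (fun n => w n ^ 2)) := by
    intro w hw
    rw [hT]
    apply hM.dom.abs_le_const hM
    intro b
    rw [abs_mul]
    refine mul_le_mul (hf b) ?_ (abs_nonneg _) hC.le
    refine (hM.cs (hFb1 b) hw).trans ?_
    exact mul_le_of_le_one_left (Real.sqrt_nonneg _) (hFsq b)
  obtain ⟨w, hw, hTw⟩ := hM.ritz hTb hε20
  set s := √(M (fun n => w n ^ 2)) with hs
  have hs0 : 0 ≤ s := Real.sqrt_nonneg _
  have hs2 : s ^ 2 = M (fun n => w n ^ 2) :=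
    Real.sq_sqrt (hM.nonneg (fun n => w n ^ 2) (by fun_prop) (fun n => sq_nonneg _))
  -- step 1
  have h1 : |M (fun b => f b * G (fun n => F b n)) - T u| ≤ C * ε1 := by
    rw [hT]
    apply hcmp _ _ _ hε10.le hGF (hin u hu)
    intro b
    refine (hGu _ (hFb1 b)).trans ?_
    exact mul_le_of_le_one_right hε10.le (hFsq b)
  -- step 2
  have h2 : |T u| ≤ 2 * s + 2 * ε2 := by
    have ha := hTw u hu
    have hb := hM.cs hu hw
    have hc : ε2 * √(M (fun n => u n ^ 2)) ≤ ε2 * 2 := by gcongr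
    have hd : √(M (fun n => u n ^ 2)) * s ≤ 2 * s := by gcongr
    have he := abs_sub_abs_le_abs_sub (T u) (M (fun n => u n * w n))
    linarith
  -- step 3
  have h3 : |T w - M (fun b => f b * T (fun n => F b n))| ≤ C * ε2 := by
    rw [hT w]
    apply hcmp _ _ _ hε20.le (hin w hw)
      ⟨C, fun b => (hTb _ (hFb1 b)).trans (mul_le_of_le_one_right hC.le (hFsq b))⟩
    intro b
    rw [abs_sub_comm]
    refine (hTw _ (hFb1 b)).trans ?_
    exact mul_le_of_le_one_right hε20.le (hFsq b)
  have h4 : |M (fun b => f b * T (fun n => F b n))| ≤ δ ^ 2 / (96 * C) * C := by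
    apply hfa
    · exact theta_ap hM hF0 hF1 hl hFs hC hf
    · intro b
      exact (hTb _ (hFb1 b)).trans (mul_le_of_le_one_right hC.le (hFsq b))
  have h5 := hTw w hw
  have h6 : M (fun n => w n * w n) = s ^ 2 := by rw [hs2]; simp only [sq]
  rw [h6, ← hs] at h5
  have hCe : δ ^ 2 / (96 * C) * C = δ ^ 2 / 96 := by field_simp
  have hε2a : ε2 ≤ δ / 8 := min_le_left _ _
  have hε2b : C * ε2 ≤ δ ^ 2 / 96 := by
    rw [← hCe, mul_comm]; gcongr; exact min_le_right _ _
  have hε1a : C * ε1 ≤ δ / 4 := by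
    calc C * ε1 ≤ C * (δ / (4 * C)) := by gcongr; exact min_le_right _ _
      _ = δ / 4 := by field_simp
  have hsδ : s ≤ δ / 4 := by
    rw [hCe] at h4
    rw [abs_le] at h3 h4 h5
    have h7 : s ^ 2 ≤ δ ^ 2 / 48 + ε2 * s := by linarith
    by_contra hcon
    push Not at hcon
    nlinarith
  have he := abs_sub_abs_le_abs_sub (M (fun b => f b * G (fun n => F b n))) (T u)
  linarith

theorem lemmaW' (hM : IsMean M) (hF0 : ∀ b n, 0 ≤ F b n) (hF1 : ∀ b n, F b n ≤ 1)
    {l k : ℤ} (hl : 0 < l) (hFs : ∀ b n, F (b + l) n = F b (n + k))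
    {G : Fn} (hG : Dom M G) {V κ : ℤ → ℝ} (hV : ∀ n, |V n| ≤ 1) (hκ : AP κ)
    {δ : ℝ} (hδ : 0 < δ) : ∃ e : ℝ, 0 < e ∧ ∀ f : ℤ → ℝ, (∀ b, |f b| ≤ 1) →
      (∀ a, AP a → ∀ D, (∀ n, |a n| ≤ D) → |M (fun n => f n * a n)| ≤ e * D) →
      |M (fun b => f b * G (fun n => V n * κ (b - n) * F b n))| ≤ δ := by
  classical
  obtain ⟨K, _, col, r, hr⟩ := hκ.rep (half_pos hδ)
  obtain ⟨C, hC, hκC⟩ := hκ.bdd.pos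
  obtain ⟨e, he, H⟩ := lemmaW hM hF0 hF1 hl hFs hC (δ := δ / (2 * (Fintype.card K + 1)))
    (by positivity)
  refine ⟨e / C, by positivity, fun f hf hfa => ?_⟩
  have hfb : Bdd f := ⟨1, hf⟩
  have hVb : Bdd V := ⟨1, hV⟩
  have hκb := hκ.bdd
  have hFb : Bdd (fun z : ℤ × ℤ => F z.1 z.2) :=
    ⟨1, fun z => by rw [abs_of_nonneg (hF0 _ _)]; exact hF1 _ _⟩
  have hFb1 : ∀ b, Bdd (fun n => F b n) := fun b => hFb.comp (fun n => (b, n))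
  let I : K → ℤ → ℝ := fun k n => if col (-n) = k then 1 else 0
  have hI : ∀ k n, |I k n| ≤ 1 := by intro k n; simp only [I]; split_ifs <;> simp
  have hIb : ∀ k, Bdd (I k) := fun k => ⟨1, hI k⟩
  let P : ℤ → ℝ := fun b => ∑ k, κ (b + r k) * G (fun n => (V n * I k n) * F b n)
  have hk : ∀ k, |M (fun b => (f b * κ (b + r k)) * G (fun n => (V n * I k n) * F b n))|
      ≤ δ / (2 * (Fintype.card K + 1)) := by
    intro k
    refine H (fun b => f b * κ (b + r k)) ?_ ?_ (G.mulBy (fun n => V n * I k n)) ?_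
    · intro b
      rw [abs_mul]
      calc _ ≤ 1 * C := mul_le_mul (hf b) (hκC _) (abs_nonneg _) zero_le_one
        _ = C := one_mul C
    · intro a ha D hD
      have := hfa (fun n => κ (n + r k) * a n) ((hκ.trans (r k)).mul ha) (C * D) (by
        intro n
        rw [abs_mul]
        exact mul_le_mul (hκC _) (hD n) (abs_nonneg _) hC.le)
      have e1 : e / C * (C * D) = e * D := by field_simp
      rw [e1] at this
      simpa only [mul_assoc] using this
    · intro w hw
      have hIk := hIb k
      refine (hG.abs_le_sqrt hM (f := fun n => V n * I k n * w n) (by fun_prop)).trans ?_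
      apply Real.sqrt_le_sqrt
      apply hM.dom.mono (by fun_prop) (by fun_prop)
      intro n
      rw [mul_pow]
      apply mul_le_of_le_one_left (sq_nonneg _)
      rw [← sq_abs, abs_mul]
      exact pow_le_one₀ (by positivity) (mul_le_one₀ (hV n) (abs_nonneg _) (hI k n))
  have hGb : ∀ k, Bdd (fun b => G (fun n => (V n * I k n) * F b n)) := fun k =>
    hG.bdd_inner hM (F := fun b n => (V n * I k n) * F b n) (by have := hIb k; fun_prop)
  have hGb2 : Bdd (fun b => G (fun n => V n * κ (b - n) * F b n)) :=
    hG.bdd_inner hM (F := fun b n => V n * κ (b - n) * F b n) (by fun_prop)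
  have hPb : Bdd P := bdd_sum _ (fun k => bdd_mul (hκb.comp _) (hGb k))
  have hPf : |M (fun b => f b * P b)| ≤ δ / 2 := by
    have e1 : (fun b => f b * P b) = fun b => ∑ k, (f b * κ (b + r k)) *
        G (fun n => (V n * I k n) * F b n) := by
      ext b; simp only [P, Finset.mul_sum, mul_assoc]
    rw [e1, Fn.sum]
    refine (Finset.abs_sum_le_sum_abs _ _).trans ?_
    refine (Finset.sum_le_sum (fun k _ => hk k)).trans ?_
    simp only [Finset.sum_const, Finset.card_univ, nsmul_eq_mul]
    rw [← mul_div_assoc, div_le_div_iff₀ (by positivity) (by positivity)]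
    nlinarith
  have hdiff : |M (fun b => f b * G (fun n => V n * κ (b - n) * F b n)) - M (fun b => f b * P b)|
      ≤ δ / 2 := by
    rw [← Fn.sub]
    apply hM.dom.abs_le_const hM
    intro b
    rw [← mul_sub, abs_mul]
    have : |G (fun n => V n * κ (b - n) * F b n) - P b| ≤ δ / 2 := by
      have e2 : P b = G (fun n => V n * κ (b + r (col (-n))) * F b n) := by
        simp only [P]
        have : ∀ k ∈ (Finset.univ : Finset K), κ (b + r k) * G (fun n => (V n * I k n) * F b n) =
            G (fun n => κ (b + r k) * ((V n * I k n) * F b n)) := fun k _ => by rw [Fn.cmul]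
        rw [Finset.sum_congr rfl this, ← Fn.sum]
        congr 1; ext n
        have : ∀ k, κ (b + r k) * ((V n * I k n) * F b n) =
          if col (-n) = k then V n * κ (b + r k) * F b n else 0 := by
          intro k; simp only [I]; split_ifs <;> simp; ring
        simp only [this, Finset.sum_ite_eq, Finset.mem_univ, if_true]
      rw [e2, ← Fn.sub]
      apply hG.abs_le_const hM
      intro n
      have h1 := hr (-n) b
      have e3 : V n * κ (b - n) * F b n - V n * κ (b + r (col (-n))) * F b n =
        V n * F b n * (κ (-n + b) - κ (r (col (-n)) + b)) := by
        rw [show b - n = -n + b by ring, show b + r (col (-n)) = r (col (-n)) + b by ring]; ring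
      rw [e3, abs_mul]
      refine (mul_le_of_le_one_left (abs_nonneg _) ?_).trans h1
      rw [abs_mul, abs_of_nonneg (hF0 b n)]
      exact mul_le_one₀ (hV n) (hF0 _ _) (hF1 _ _)
    calc _ ≤ 1 * (δ / 2) := mul_le_mul (hf b) this (abs_nonneg _) zero_le_one
      _ = δ / 2 := one_mul _
  have he := abs_sub_abs_le_abs_sub (M (fun b => f b * G (fun n => V n * κ (b - n) * F b n)))
    (M (fun b => f b * P b))
  linarith

end W
end MBLB


namespace MBLB

section Avg
variable {M H : Fn}

theorem kavg (hM : IsMean M) {κ : ℤ → ℝ} (hκ : AP κ) (h1 : M κ = 1) {ε : ℝ} (hε : 0 < ε) :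
    ∃ L0 : ℕ, 0 < L0 ∧ ∀ L, L0 ≤ L → ∀ c : ℤ,
      |(L : ℝ)⁻¹ * ∑ t ∈ Finset.range L, κ (c + t) - 1| ≤ ε := by
  obtain ⟨L0, h⟩ := hκ.unif hM hε
  refine ⟨L0 + 1, by omega, fun L hL c => ?_⟩
  have := h L (by omega) c
  have hLp : (0 : ℝ) < L := by exact_mod_cast (by omega : 0 < L)
  rw [h1, mul_one] at this
  have e : (L : ℝ)⁻¹ * ∑ t ∈ Finset.range L, κ (c + t) - 1 =
      (L : ℝ)⁻¹ * (∑ t ∈ Finset.range L, κ (c + t) - L) := by field_simp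
  rw [e, abs_mul, abs_of_pos (inv_pos.2 hLp)]
  calc _ ≤ (L : ℝ)⁻¹ * (ε * L) := by gcongr
    _ = ε := by field_simp

theorem slide (hM : IsMean M) {c : ℝ} (hH : ∀ f D, (∀ n, |f n| ≤ D) → |H f| ≤ c * D)
    {Φ : ℤ → ℤ → ℝ} (hΦ : Bdd (fun z : ℤ × ℤ => Φ z.1 z.2)) {L : ℕ} (hL : 0 < L) :
    M (fun b => H (Φ b)) =
      M (fun b => H (fun n => (L : ℝ)⁻¹ * ∑ t ∈ Finset.range L, Φ (b + t) n)) := by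
  have hb : Bdd (fun b => H (Φ b)) := by
    obtain ⟨D, hD⟩ := hΦ
    exact ⟨c * D, fun b => hH _ _ (fun n => hD (b, n))⟩
  have e : (fun b : ℤ => H (fun n => (L : ℝ)⁻¹ * ∑ t ∈ Finset.range L, Φ (b + t) n)) =
      fun b => (L : ℝ)⁻¹ * ∑ t ∈ Finset.range L, H (Φ (b + t)) := by
    ext b; rw [Fn.cmul, Fn.sum]
  rw [e, Fn.cmul, Fn.sum]
  have : ∀ t ∈ Finset.range L, M (fun b => H (Φ (b + (t : ℤ)))) = M (fun b => H (Φ b)) :=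
    fun t _ => hM.shift (fun b => H (Φ b)) t hb
  rw [Finset.sum_congr rfl this]
  have hLp : (0 : ℝ) < L := by exact_mod_cast hL
  simp only [Finset.sum_const, Finset.card_range, nsmul_eq_mul]
  field_simp

theorem avg_eq (hM : IsMean M) {c : ℝ} (hc : 0 ≤ c)
    (hH : ∀ f D, (∀ n, |f n| ≤ D) → |H f| ≤ c * D)
    {κ : ℤ → ℝ} (hκ : AP κ) (h1 : M κ = 1) {η : ℤ → ℝ} (hη : Bdd η) :
    M (fun b => H (fun n => η n * κ (b - n))) = H η := by
  obtain ⟨C, hC, hηC⟩ := hη.pos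
  have hκb := hκ.bdd
  have hcl : ∀ ε : ℝ, 0 < ε → |M (fun b => H (fun n => η n * κ (b - n))) - H η| ≤ ε := by
    intro ε hε
    obtain ⟨L, hL, hk⟩ := kavg hM hκ h1 (ε := ε / ((c + 1) * C)) (by positivity)
    rw [slide hM hH (Φ := fun b n => η n * κ (b - n)) (by fun_prop) hL, ← hM.const (H η), ← Fn.sub]
    apply hM.dom.abs_le_const hM
    intro b
    rw [← Fn.sub]
    refine (hH _ (ε / (c + 1)) ?_).trans ?_
    · intro n
      have e : (L : ℝ)⁻¹ * ∑ t ∈ Finset.range L, η n * κ (b + t - n) - η n =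
        η n * ((L : ℝ)⁻¹ * ∑ t ∈ Finset.range L, κ (b - n + t) - 1) := by
        rw [← Finset.mul_sum]
        have : ∀ t : ℕ, b + (t : ℤ) - n = b - n + t := fun t => by ring
        simp only [this]
        ring
      rw [e, abs_mul]
      calc _ ≤ C * (ε / ((c + 1) * C)) := mul_le_mul (hηC n) (hk L le_rfl _) (abs_nonneg _) hC.le
        _ = ε / (c + 1) := by field_simp
    · rw [← mul_div_assoc, div_le_iff₀ (by positivity)]
      nlinarith
  have h0 : |M (fun b => H (fun n => η n * κ (b - n))) - H η| ≤ 0 :=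
    le_of_forall_pos_le_add (fun ε hε => by simpa using hcl ε hε)
  have := abs_eq_zero.1 (le_antisymm h0 (abs_nonneg _))
  linarith

theorem avg_bound (hM : IsMean M) {c : ℝ} (hc : 0 ≤ c)
    (hH : ∀ f D, (∀ n, |f n| ≤ D) → |H f| ≤ c * D)
    {κ : ℤ → ℝ} (hκ : AP κ) (hκ0 : ∀ n, 0 ≤ κ n) (h1 : M κ = 1) {V : ℤ → ℝ} (hV : ∀ n, |V n| ≤ 1)
    {F : ℤ → ℤ → ℝ} (hF0 : ∀ b n, 0 ≤ F b n) (hF1 : ∀ b n, F b n ≤ 1) :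
    |M (fun b => H (fun n => V n * κ (b - n) * F b n))| ≤ c * 2 := by
  have hκb := hκ.bdd
  have hVb : Bdd V := ⟨1, hV⟩
  have hFb : Bdd (fun z : ℤ × ℤ => F z.1 z.2) :=
    ⟨1, fun z => by rw [abs_of_nonneg (hF0 _ _)]; exact hF1 _ _⟩
  obtain ⟨L, hL, hk⟩ := kavg hM hκ h1 one_pos
  rw [slide hM hH (Φ := fun b n => V n * κ (b - n) * F b n) (by fun_prop) hL]
  apply hM.dom.abs_le_const hM
  intro b
  apply hH
  intro n
  have h2 := (abs_le.1 (hk L le_rfl (b - n))).2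
  have h3 : |∑ t ∈ Finset.range L, V n * κ (b + t - n) * F (b + t) n| ≤
      ∑ t ∈ Finset.range L, κ (b - n + t) := by
    refine (Finset.abs_sum_le_sum_abs _ _).trans ?_
    apply Finset.sum_le_sum
    intro t _
    have : b + (t : ℤ) - n = b - n + t := by ring
    rw [this, abs_mul, abs_mul, abs_of_nonneg (hκ0 _), abs_of_nonneg (hF0 _ _)]
    calc _ ≤ 1 * κ (b - n + t) * 1 := by
          gcongr
          · exact hF0 _ _
          · exact mul_nonneg zero_le_one (hκ0 _)
          · exact hκ0 _
          · exact hV n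
          · exact hF1 _ _
      _ = _ := by ring
  rw [abs_mul, abs_of_nonneg (by positivity)]
  have : (L : ℝ)⁻¹ * |∑ t ∈ Finset.range L, V n * κ (b + t - n) * F (b + t) n| ≤
    (L : ℝ)⁻¹ * ∑ t ∈ Finset.range L, κ (b - n + t) := by gcongr
  linarith

theorem mean_reflect (hM : IsMean M) {κ : ℤ → ℝ} (hκ : AP κ) (h1 : M κ = 1) (b : ℤ) :
    M (fun n => κ (b - n)) = 1 := by
  have hκb := hκ.bdd
  have hcl : ∀ ε : ℝ, 0 < ε → |M (fun n => κ (b - n)) - 1| ≤ ε := by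
    intro ε hε
    obtain ⟨L, hL, hk⟩ := kavg hM hκ h1 hε
    have hLp : (0 : ℝ) < L := by exact_mod_cast hL
    have e : M (fun n => κ (b - n)) =
        M (fun n => (L : ℝ)⁻¹ * ∑ t ∈ Finset.range L, κ (b - (L - 1) - n + t)) := by
      rw [Fn.cmul, Fn.sum]
      have : ∀ t ∈ Finset.range L, M (fun n => κ (b - (L - 1) - n + (t : ℤ))) =
          M (fun n => κ (b - n)) := by
        intro t _
        rw [← hM.shift (fun n => κ (b - n)) ((L : ℤ) - 1 - t) (by fun_prop)]
        congr 1; ext n; congr 1; ring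
      rw [Finset.sum_congr rfl this]
      simp only [Finset.sum_const, Finset.card_range, nsmul_eq_mul]
      field_simp
    rw [e, ← hM.const 1, ← Fn.sub]
    apply hM.dom.abs_le_const hM
    intro n
    exact hk L le_rfl _
  have h0 : |M (fun n => κ (b - n)) - 1| ≤ 0 :=
    le_of_forall_pos_le_add (fun ε hε => by simpa using hcl ε hε)
  have := abs_eq_zero.1 (le_antisymm h0 (abs_nonneg _))
  linarith

theorem Dom.sup_bound (hG : Dom M H) (hM : IsMean M) : ∀ f D, (∀ n, |f n| ≤ D) → |H f| ≤ 1 * D :=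
  fun f D h => by rw [one_mul]; exact hG.abs_le_const hM h

end Avg

/-- the dynamical data used in the main argument -/
structure Sys (M G : Fn) (F : ℤ → ℤ → ℝ) (l k : ℤ) {I : Type} (U : Filter I) (κ : I → ℤ → ℝ) :
    Prop where
  hM : IsMean M
  hF0 : ∀ b n, 0 ≤ F b n
  hF1 : ∀ b n, F b n ≤ 1
  hl : 0 < l
  hFs : ∀ b n, F (b + l) n = F b (n + k)
  ne : U.NeBot
  k0 : ∀ i n, 0 ≤ κ i n
  kap : ∀ i, AP (κ i)
  k1 : ∀ i, M (κ i) = 1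
  loc : ∀ p, AP p → ∀ ε : ℝ, 0 < ε → ∀ᶠ i in U, ∀ h, κ i h ≠ 0 → ∀ t, |p (t + h) - p t| ≤ ε
  lim : ∀ η, Bdd η →
    Tendsto (fun i => M (fun b => M (fun n => η n * κ i (b - n) * F b n))) U (𝓝 (G η))

section Main
variable {M G : Fn} {F : ℤ → ℤ → ℝ} {l k : ℤ} {I : Type} {U : Filter I} {κ : I → ℤ → ℝ}

theorem Sys.bddF (S : Sys M G F l k U κ) : Bdd (fun z : ℤ × ℤ => F z.1 z.2) :=
  ⟨1, fun z => by rw [abs_of_nonneg (S.hF0 _ _)]; exact S.hF1 _ _⟩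

theorem Sys.upper (S : Sys M G F l k U κ) {H : Fn} (hH : Dom M H) {η : ℤ → ℝ} (hη : Bdd η)
    (h0 : ∀ n, 0 ≤ η n) (i : I) :
    M (fun b => H (fun n => η n * κ i (b - n) * F b n)) ≤ H η := by
  have hFb := S.bddF
  have hκb := (S.kap i).bdd
  have hFb1 : ∀ b, Bdd (fun n => F b n) := fun b => hFb.comp (fun n => (b, n))
  rw [← avg_eq S.hM zero_le_one (hH.sup_bound S.hM) (S.kap i) (S.k1 i) hη]
  apply S.hM.dom.mono
  · exact hH.bdd_inner S.hM (F := fun b n => η n * κ i (b - n) * F b n) (by fun_prop)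
  · exact hH.bdd_inner S.hM (F := fun b n => η n * κ i (b - n)) (by fun_prop)
  · intro b
    have := hFb1 b
    apply hH.mono (by fun_prop) (by fun_prop)
    intro n
    exact mul_le_of_le_one_right (mul_nonneg (h0 n) (S.k0 _ _)) (S.hF1 _ _)

theorem Sys.dom (S : Sys M G F l k U κ) : Dom M G := by
  have hFb := S.bddF
  have hFb1 : ∀ b, Bdd (fun n => F b n) := fun b => hFb.comp (fun n => (b, n))
  have := S.ne
  constructor
  · intro f hf h0
    refine ge_of_tendsto' (S.lim f hf) (fun i => ?_)
    have hκb := (S.kap i).bdd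
    apply S.hM.nonneg
    · exact S.hM.dom.bdd_inner S.hM (F := fun b n => f n * κ i (b - n) * F b n) (by fun_prop)
    · intro b
      have := hFb1 b
      apply S.hM.nonneg _ (by fun_prop)
      intro n
      exact mul_nonneg (mul_nonneg (h0 n) (S.k0 _ _)) (S.hF0 _ _)
  · intro f hf h0
    exact le_of_tendsto' (S.lim f hf) (fun i => S.upper S.hM.dom hf h0 i)

theorem proj (hM : IsMean M) {V : ℤ → ℝ} (hV0 : ∀ n, 0 ≤ V n) (hV1 : ∀ n, V n ≤ 1) {e : ℝ}
    (he : 0 < e) : ∃ p, AP p ∧ (∀ n, 0 ≤ p n) ∧ (∀ n, p n ≤ 1) ∧ ∀ q, AP q →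
      M (fun n => (V n - p n) ^ 2) ≤ M (fun n => (V n - q n) ^ 2) + e ^ 2 := by
  have hVb : Bdd V := ⟨1, fun n => by rw [abs_of_nonneg (hV0 n)]; exact hV1 n⟩
  let S : Set ℝ := {x | ∃ q, AP q ∧ x = M (fun n => (V n - q n) ^ 2)}
  have hS : BddBelow S := by
    refine ⟨0, ?_⟩
    rintro x ⟨q, hq, rfl⟩
    have := hq.bdd
    exact hM.nonneg _ (by fun_prop) (fun n => sq_nonneg _)
  have hne : S.Nonempty := ⟨_, _, AP.const 0, rfl⟩
  obtain ⟨x, ⟨p, hp, rfl⟩, hx⟩ := exists_lt_of_csInf_lt hne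
    (lt_add_of_pos_right (sInf S) (sq_pos_of_pos he))
  have hpb := hp.bdd
  let p' : ℤ → ℝ := fun n => max 0 (min (p n) 1)
  have hp' : AP p' := (AP.const 0).max (hp.min (AP.const 1))
  refine ⟨p', hp', fun n => le_max_left _ _, fun n => max_le zero_le_one (min_le_right _ _),
    fun q hq => ?_⟩
  have h1 : sInf S ≤ M (fun n => (V n - q n) ^ 2) := csInf_le hS ⟨q, hq, rfl⟩
  have hpb' := hp'.bdd
  have h2 : M (fun n => (V n - p' n) ^ 2) ≤ M (fun n => (V n - p n) ^ 2) := by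
    apply hM.dom.mono (by fun_prop) (by fun_prop)
    intro n
    have := hV0 n
    have := hV1 n
    simp only [p']
    rcases le_total (p n) 1 with h | h
    · rw [min_eq_left h]
      rcases le_total 0 (p n) with h' | h'
      · rw [max_eq_right h']
      · rw [max_eq_left h']; nlinarith
    · rw [min_eq_right h, max_eq_right zero_le_one]; nlinarith
  linarith

theorem proj_orth (hM : IsMean M) {V p : ℤ → ℝ} (hV : Bdd V) (hp : AP p) {e : ℝ} (he : 0 < e)
    (h : ∀ q, AP q → M (fun n => (V n - p n) ^ 2) ≤ M (fun n => (V n - q n) ^ 2) + e ^ 2)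
    {a : ℤ → ℝ} (ha : AP a) {D : ℝ} (hD : ∀ n, |a n| ≤ D) :
    |M (fun n => (V n - p n) * a n)| ≤ e * D := by
  have hab := ha.bdd
  have hpb := hp.bdd
  have key : ∀ t : ℝ, 0 ≤ M (fun n => a n ^ 2) * (t * t) +
      (-2 * M (fun n => (V n - p n) * a n)) * t + e ^ 2 := by
    intro t
    have h1 := h (fun n => p n + t * a n) (hp.add (ha.cmul t))
    have e1 : (fun n => (V n - (p n + t * a n)) ^ 2) =
        fun n => ((V n - p n) ^ 2 - (2 * t) * ((V n - p n) * a n)) + (t * t) * a n ^ 2 := by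
      ext n; ring
    rw [e1, Fn.add, Fn.sub, Fn.cmul, Fn.cmul] at h1
    linarith
  have hd := discrim_le_zero key
  unfold discrim at hd
  have hD0 : 0 ≤ D := (abs_nonneg _).trans (hD 0)
  have ha2 : M (fun n => a n ^ 2) ≤ D ^ 2 := hM.le_const (by fun_prop) (fun n => by
    rw [← sq_abs]; exact pow_le_pow_left₀ (abs_nonneg _) (hD n) 2)
  apply abs_le_of_sq_le_sq _ (by positivity)
  have := mul_le_mul_of_nonneg_left ha2 (sq_nonneg e)
  nlinarith

theorem proj_close (hM : IsMean M) {V p p' : ℤ → ℝ} (hV : Bdd V) (hp : AP p) (hp' : AP p')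
    {e e' : ℝ} (he' : 0 ≤ e') (hee : e' ≤ e)
    (h : ∀ q, AP q → M (fun n => (V n - p n) ^ 2) ≤ M (fun n => (V n - q n) ^ 2) + e ^ 2)
    (h' : ∀ q, AP q → M (fun n => (V n - p' n) ^ 2) ≤ M (fun n => (V n - q n) ^ 2) + e' ^ 2) :
    M (fun n => |p n - p' n|) ≤ 2 * e := by
  have hpb := hp.bdd
  have hpb' := hp'.bdd
  refine (hM.abs_le_sqrt (by fun_prop)).trans ?_
  rw [Real.sqrt_le_left (by linarith)]
  have hq : AP (fun n => (1 / 2) * (p n + p' n)) := (hp.add hp').cmul _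
  have h1 := h _ hq
  have h2 := h' _ hq
  have e1 : (fun n => (p n - p' n) ^ 2) = fun n => 2 * ((V n - p n) ^ 2 + (V n - p' n) ^ 2)
      - 4 * (V n - (1 / 2) * (p n + p' n)) ^ 2 := by ext n; ring
  rw [e1, Fn.sub, Fn.cmul, Fn.cmul, Fn.add]
  nlinarith

theorem Sys.lower (S : Sys M G F l k U κ) {V : ℤ → ℝ} (hV : ∀ n, V n = 0 ∨ V n = 1)
    (hg : 0 < G V) :
    ∀ᶠ i in U, G V ^ 2 / 2 ≤ M (fun b => G (fun n => V n * κ i (b - n) * F b n)) := by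
  have hM := S.hM
  have hG := S.dom
  have hFb := S.bddF
  have hFb1 : ∀ b, Bdd (fun n => F b n) := fun b => hFb.comp (fun n => (b, n))
  have hV0 : ∀ n, 0 ≤ V n := fun n => by rcases hV n with h | h <;> simp [h]
  have hV1 : ∀ n, V n ≤ 1 := fun n => by rcases hV n with h | h <;> simp [h]
  have hVa : ∀ n, |V n| ≤ 1 := fun n => by rw [abs_of_nonneg (hV0 n)]; exact hV1 n
  have hVb : Bdd V := ⟨1, hVa⟩
  have hVV : ∀ n, V n ^ 2 = V n := fun n => by rcases hV n with h | h <;> simp [h]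
  set g := G V with hgdef
  have hg1 : g ≤ 1 := hG.le_const hM hV0 hV1
  set ε : ℝ := g ^ 2 / 16 with hε
  have hε0 : 0 < ε := by positivity
  obtain ⟨w, hw, hr⟩ := hM.ritz (G := G) (C := 1)
    (fun f hf => by simpa using hG.abs_le_sqrt hM hf) hε0
  -- the error functional
  let H : Fn := G - M.mulBy w
  have hH : ∀ f, H f = G f - M (fun n => f n * w n) := by
    intro f
    have : M (fun n => f n * w n) = M (fun n => w n * f n) := by simp only [mul_comm]
    rw [this]; rfl
  have hHb : ∀ f D, (∀ n, |f n| ≤ D) → |H f| ≤ ε * D := by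
    intro f D hD
    have hD0 : 0 ≤ D := (abs_nonneg _).trans (hD 0)
    have hfb : Bdd f := ⟨D, hD⟩
    rw [hH]
    refine (hr f hfb).trans ?_
    gcongr
    rw [Real.sqrt_le_left hD0]
    exact hM.le_const (by fun_prop) (fun n => by
      rw [← sq_abs]; exact pow_le_pow_left₀ (abs_nonneg _) (hD n) 2)
  set x := √(M (fun n => w n ^ 2 * V n)) with hx
  have hx0 : 0 ≤ x := Real.sqrt_nonneg _
  have hx2 : x ^ 2 = M (fun n => w n ^ 2 * V n) := Real.sq_sqrt
    (hM.nonneg _ (by fun_prop) (fun n => mul_nonneg (sq_nonneg _) (hV0 n)))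
  have hxx : √(M (fun n => (w n * V n) ^ 2)) = x := by
    rw [hx]; congr 2; ext n; rw [mul_pow, hVV]
  have hxg : g - ε ≤ x := by
    have h1 := hHb V 1 hVa
    rw [hH, mul_one] at h1
    have h2 := hM.abs_le_sqrt (f := fun n => w n * V n) (by fun_prop)
    rw [hxx] at h2
    have h3 := hM.dom.abs_le (f := fun n => w n * V n) (by fun_prop)
    have h4 : M (fun n => w n * V n) = M (fun n => V n * w n) := by simp only [mul_comm]
    rw [h4] at h3
    have h5 := le_abs_self (M (fun n => V n * w n))
    have h6 := (abs_le.1 h1).2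
    linarith
  have hGw : x ^ 2 - ε * x ≤ G (fun n => w n * V n) := by
    have h1 := hr (fun n => w n * V n) (by fun_prop)
    rw [hxx] at h1
    have h2 : M (fun n => w n * V n * w n) = x ^ 2 := by
      rw [hx2]; congr 1; ext n; ring
    rw [h2] at h1
    have := (abs_le.1 h1).1
    linarith
  have hfin : g ^ 2 / 2 + 2 * ε < G (fun n => w n * V n) := by
    have h1 : ε ≤ g / 16 := by rw [hε]; nlinarith
    have h2 : 15 / 16 * g ≤ x := by linarith
    nlinarith
  have hev := (S.lim (fun n => w n * V n) (by fun_prop)).eventually (lt_mem_nhds hfin)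
  filter_upwards [hev] with i hi
  have h1 := avg_bound hM hε0.le hHb (S.kap i) (S.k0 i) (S.k1 i) hVa S.hF0 S.hF1
  have hκb := (S.kap i).bdd
  have h2 : M (fun b => H (fun n => V n * κ i (b - n) * F b n)) =
      M (fun b => G (fun n => V n * κ i (b - n) * F b n)) -
      M (fun b => M (fun n => w n * V n * κ i (b - n) * F b n)) := by
    rw [← Fn.sub]; congr 1; ext b; rw [hH]; congr 2; ext n; ring
  rw [h2] at h1
  have := (abs_le.1 h1).1
  linarith

theorem Sys.main (S : Sys M G F l k U κ) {V : ℤ → ℝ} (hV : ∀ n, V n = 0 ∨ V n = 1)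
    (hg : 0 < G V) (B0 : ℤ) :
    ∃ b, B0 < b ∧ V b = 1 ∧ 0 < G (fun n => V n * F b n) := by
  by_contra hcon
  push Not at hcon
  have hM := S.hM
  have hG := S.dom
  have hFb := S.bddF
  have hFb1 : ∀ b, Bdd (fun n => F b n) := fun b => hFb.comp (fun n => (b, n))
  have hV0 : ∀ n, 0 ≤ V n := fun n => by rcases hV n with h | h <;> simp [h]
  have hV1 : ∀ n, V n ≤ 1 := fun n => by rcases hV n with h | h <;> simp [h]
  have hVa : ∀ n, |V n| ≤ 1 := fun n => by rw [abs_of_nonneg (hV0 n)]; exact hV1 n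
  have hVb : Bdd V := ⟨1, hVa⟩
  have hg1 : G V ≤ 1 := hG.le_const hM hV0 hV1
  have hlow := S.lower hV hg
  set τ : ℝ := G V ^ 2 / 8 with hτ
  have hτ0 : 0 < τ := by positivity
  have hτ1 : τ ≤ 1 := by rw [hτ]; nlinarith
  set e1 : ℝ := τ ^ 2 / 4 with he1
  have he10 : 0 < e1 := by positivity
  obtain ⟨p, hp, hp0, hp1, hpm⟩ := proj hM hV0 hV1 he10
  have hpb := hp.bdd
  have := S.ne
  obtain ⟨i, hi, hloc⟩ := (hlow.and (S.loc p hp e1 he10)).exists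
  have hκb := (S.kap i).bdd
  obtain ⟨C, hC, hκC⟩ := hκb.pos
  set ψ : ℤ → ℝ := fun b => G (fun n => V n * κ i (b - n) * F b n) with hψ
  have hnn : ∀ b n, 0 ≤ V n * κ i (b - n) * F b n := fun b n =>
    mul_nonneg (mul_nonneg (hV0 n) (S.k0 _ _)) (S.hF0 _ _)
  have hψ0 : ∀ b, 0 ≤ ψ b := fun b => by
    have := hFb1 b
    exact hG.nonneg _ (by fun_prop) (hnn b)
  have hψ1 : ∀ b, ψ b ≤ 1 := fun b => by
    have := hFb1 b
    rw [← mean_reflect hM (S.kap i) (S.k1 i) b]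
    refine (hG.mono (g := fun n => κ i (b - n)) (by fun_prop) (by fun_prop) (fun n => ?_)).trans
      (hG.le _ (by fun_prop) (fun n => S.k0 _ _))
    calc _ ≤ 1 * κ i (b - n) * 1 := by
          gcongr
          · exact S.hF0 _ _
          · exact mul_nonneg zero_le_one (S.k0 _ _)
          · exact S.k0 _ _
          · exact hV1 n
          · exact S.hF1 _ _
      _ = _ := by ring
  have hψb : Bdd ψ := ⟨1, fun b => by rw [abs_of_nonneg (hψ0 b)]; exact hψ1 b⟩
  -- V ψ has mean zero
  have hVψ : M (fun b => V b * ψ b) = 0 := by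
    apply hM.tail _ B0 (by fun_prop)
    intro b hb
    rcases hV b with h | h
    · simp [h]
    · have h1 := hcon b hb h
      have := hFb1 b
      have h2 : ψ b ≤ C * G (fun n => V n * F b n) := by
        rw [← Fn.cmul]
        apply hG.mono (by fun_prop) (by fun_prop)
        intro n
        have := (le_abs_self _).trans (hκC (b - n))
        have := mul_le_mul_of_nonneg_right this (mul_nonneg (hV0 n) (S.hF0 b n))
        linarith
      have h3 : C * G (fun n => V n * F b n) ≤ 0 := mul_nonpos_of_nonneg_of_nonpos hC.le h1
      have : ψ b = 0 := le_antisymm (h2.trans h3) (hψ0 b)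
      simp [this]
  obtain ⟨e0, he0, hW⟩ := lemmaW' hM S.hF0 S.hF1 S.hl S.hFs hG hVa (S.kap i) he10
  have he2 : 0 < min e0 e1 := by positivity
  obtain ⟨p', hp', hp0', hp1', hpm'⟩ := proj hM hV0 hV1 he2
  have hpb' := hp'.bdd
  have hpp := hM.dom.mono (f := fun b => |p b - p' b| * ψ b) (g := fun b => |p b - p' b|)
    (by fun_prop) (by fun_prop) (fun b => mul_le_of_le_one_right (abs_nonneg _) (hψ1 b))
  have hcl := proj_close hM hVb hp hp' he2.le (min_le_right _ _) hpm hpm'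
  have hW1 := hW (fun b => V b - p' b) (fun b => by
      rw [abs_le]; constructor <;> linarith [hV0 b, hV1 b, hp0' b, hp1' b]) (by
    intro a ha D hD
    refine (proj_orth hM hVb hp' he2 hpm' ha hD).trans ?_
    have hD0 : 0 ≤ D := (abs_nonneg _).trans (hD 0)
    gcongr
    exact min_le_left _ _)
  have hW2 : |M (fun b => (V b - p' b) * ψ b)| ≤ e1 := hW1
  have hpψ : M (fun b => p b * ψ b) ≤ 3 * e1 := by
    have h1 : M (fun b => p b * ψ b) ≤ M (fun b => |p b - p' b| * ψ b)
        + (M (fun b => V b * ψ b) - M (fun b => (V b - p' b) * ψ b)) := by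
      rw [← Fn.sub, ← Fn.add]
      apply hM.dom.mono (by fun_prop) (by fun_prop)
      intro b
      have := mul_le_mul_of_nonneg_right (le_abs_self (p b - p' b)) (hψ0 b)
      linarith
    have := (abs_le.1 hW2).1
    linarith
  -- first part
  have hX : M (fun b => G (fun n => p n * V n * κ i (b - n) * F b n)) ≤ 4 * e1 := by
    have h1 : M (fun b => G (fun n => p n * V n * κ i (b - n) * F b n)) ≤
        M (fun b => p b * ψ b) + M (fun b => e1 * ψ b) := by
      rw [← Fn.add]
      apply hM.dom.mono
      · exact hG.bdd_inner hM (F := fun b n => p n * V n * κ i (b - n) * F b n) (by fun_prop)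
      · fun_prop
      · intro b
        have := hFb1 b
        rw [← add_mul]
        simp only [hψ]
        rw [← Fn.cmul G]
        apply hG.mono (by fun_prop) (by fun_prop)
        intro n
        by_cases hk : κ i (b - n) = 0
        · simp [hk]
        · have h2 := hloc (b - n) hk n
          rw [show n + (b - n) = b by ring] at h2
          have h3 := (abs_le.1 h2).1
          have := mul_le_mul_of_nonneg_right (show p n ≤ p b + e1 by linarith) (hnn b n)
          linarith
    have h2 : M (fun b => e1 * ψ b) ≤ e1 := hM.le_const (by fun_prop)
      (fun b => mul_le_of_le_one_right he10.le (hψ1 b))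
    linarith
  -- second part
  let χ : ℤ → ℝ := fun n => max 0 (1 - τ⁻¹ * p n)
  have hχ : AP χ := (AP.const 0).max ((AP.const 1).sub (hp.cmul _))
  have hχb := hχ.bdd
  have hχ0 : ∀ n, 0 ≤ χ n := fun n => le_max_left _ _
  have hχ1 : ∀ n, χ n ≤ 1 := fun n => max_le zero_le_one (by
    have := mul_nonneg (inv_nonneg.2 hτ0.le) (hp0 n); linarith)
  have hχp : ∀ n, p n * χ n ≤ τ := by
    intro n
    simp only [χ]
    rcases le_total (1 - τ⁻¹ * p n) 0 with h | h
    · rw [max_eq_left h]; simp [hτ0.le]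
    · rw [max_eq_right h]
      have : p n ≤ τ := by
        rw [sub_nonneg, inv_mul_le_iff₀ hτ0, mul_one] at h
        exact h
      have h2 := mul_nonneg (inv_nonneg.2 hτ0.le) (hp0 n)
      have := mul_le_mul this (show 1 - τ⁻¹ * p n ≤ 1 by linarith) h hτ0.le
      linarith
  have hY : M (fun b => G (fun n => (χ n * V n) * κ i (b - n) * F b n)) ≤ τ + e1 := by
    refine (S.upper hG (η := fun n => χ n * V n) (by fun_prop)
      (fun n => mul_nonneg (hχ0 n) (hV0 n)) i).trans ?_
    refine (hG.le _ (by fun_prop) (fun n => mul_nonneg (hχ0 n) (hV0 n))).trans ?_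
    have h1 := proj_orth hM hVb hp he10 hpm hχ (D := 1)
      (fun n => by rw [abs_of_nonneg (hχ0 n)]; exact hχ1 n)
    have h2 := (abs_le.1 h1).2
    have h3 : M (fun n => p n * χ n) ≤ τ := hM.le_const (by fun_prop) hχp
    have h4 : M (fun n => χ n * V n) = M (fun n => (V n - p n) * χ n) + M (fun n => p n * χ n) := by
      rw [← Fn.add]; congr 1; ext n; ring
    linarith
  have hsum : M ψ ≤ τ⁻¹ * M (fun b => G (fun n => p n * V n * κ i (b - n) * F b n)) +
      M (fun b => G (fun n => (χ n * V n) * κ i (b - n) * F b n)) := by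
    have hb1 : Bdd (fun b => G (fun n => p n * V n * κ i (b - n) * F b n)) :=
      hG.bdd_inner hM (F := fun b n => p n * V n * κ i (b - n) * F b n) (by fun_prop)
    have hb2 : Bdd (fun b => G (fun n => (χ n * V n) * κ i (b - n) * F b n)) :=
      hG.bdd_inner hM (F := fun b n => (χ n * V n) * κ i (b - n) * F b n) (by fun_prop)
    rw [← Fn.cmul, ← Fn.add]
    apply hM.dom.mono hψb (bdd_add (bdd_mul (bdd_const _) hb1) hb2)
    intro b
    have := hFb1 b
    rw [← Fn.cmul, ← Fn.add]
    apply hG.mono (by fun_prop) (by fun_prop)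
    intro n
    have h1 : 1 ≤ τ⁻¹ * p n + χ n := by
      have := le_max_right 0 (1 - τ⁻¹ * p n)
      simp only [χ]; linarith
    have := mul_le_mul_of_nonneg_right h1 (hnn b n)
    linarith
  have hX2 : τ⁻¹ * M (fun b => G (fun n => p n * V n * κ i (b - n) * F b n)) ≤ τ := by
    rw [inv_mul_le_iff₀ hτ0]
    rw [he1] at hX
    linarith
  have h8 : G V ^ 2 / 2 = 4 * τ := by rw [hτ]; ring
  have h9 : G V ^ 2 / 2 ≤ M ψ := hi
  have : e1 ≤ τ / 4 := by rw [he1]; nlinarith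
  linarith

end Main
end MBLB


namespace MBLB

theorem ultralim {I : Type} (U : Ultrafilter I) (T : I → Fn)
    (hT : ∀ f, Bdd f → ∃ C, ∀ i, |T i f| ≤ C) :
    ∃ T' : Fn, ∀ f, Bdd f → Tendsto (fun i => T i f) U (𝓝 (T' f)) := by
  have hex : ∀ f, Bdd f → ∃ x, Tendsto (fun i => T i f) U (𝓝 x) := by
    intro f hf
    obtain ⟨C, hC⟩ := hT f hf
    have := (isCompact_Icc (a := -C) (b := C)).ultrafilter_le_nhds (U.map (fun i => T i f)) (by
      simp only [Ultrafilter.coe_map, le_principal_iff, mem_map]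
      exact Filter.univ_mem' (fun i => abs_le.1 (hC i)))
    obtain ⟨x, _, hx⟩ := this
    exact ⟨x, hx⟩
  let S : Submodule ℝ (ℤ → ℝ) :=
    { carrier := {f | Bdd f}
      add_mem' := fun {a b} ha hb => bdd_add ha hb
      zero_mem' := bdd_const 0
      smul_mem' := fun c x hx => bdd_mul (bdd_const c) hx }
  choose! g hg using hex
  let T0 : S →ₗ[ℝ] ℝ :=
    { toFun := fun f => g f.1
      map_add' := fun x y => by
        have h1 := (hg x.1 x.2).add (hg y.1 y.2)
        have h2 := hg (x + y).1 (x + y).2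
        refine tendsto_nhds_unique h2 ?_
        convert h1 using 2 with i
        exact (T i).map_add _ _
      map_smul' := fun c x => by
        have h1 := (hg x.1 x.2).const_mul c
        have h2 := hg (c • x).1 (c • x).2
        refine tendsto_nhds_unique h2 ?_
        have h3 : (fun i => T i (c • x).1) = fun i => c * T i x.1 := by
          ext i; exact (T i).map_smul _ _
        rw [h3]
        exact h1 }
  obtain ⟨T', hT'⟩ := LinearMap.exists_extend T0
  refine ⟨T', fun f hf => ?_⟩
  have : T' f = g f := by
    have := LinearMap.congr_fun hT' ⟨f, hf⟩
    exact this
  rw [this]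
  exact hg f hf

theorem AP.sum {ι : Type} (s : Finset ι) {f : ι → ℤ → ℝ} (hf : ∀ i ∈ s, AP (f i)) :
    AP (fun x => ∑ i ∈ s, f i x) := by
  classical
  induction s using Finset.induction_on with
  | empty => simpa using AP.const 0
  | insert a s ha ih =>
    simp only [Finset.sum_insert ha]
    exact (hf a (Finset.mem_insert_self _ _)).add
      (ih (fun i hi => hf i (Finset.mem_insert_of_mem hi)))

/-- sup-distance of `p` to its translate -/
noncomputable def sdist (p : ℤ → ℝ) (h : ℤ) : ℝ := ⨆ t, |p (t + h) - p t|

theorem sdist_bdd {p : ℤ → ℝ} (hp : Bdd p) (h : ℤ) :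
    BddAbove (Set.range (fun t => |p (t + h) - p t|)) := by
  obtain ⟨C, hC⟩ := hp
  refine ⟨C + C, ?_⟩
  rintro x ⟨t, rfl⟩
  exact (abs_sub _ _).trans (add_le_add (hC _) (hC _))

theorem le_sdist {p : ℤ → ℝ} (hp : Bdd p) (h t : ℤ) : |p (t + h) - p t| ≤ sdist p h :=
  le_ciSup (sdist_bdd hp h) t

theorem sdist_nonneg {p : ℤ → ℝ} (hp : Bdd p) (h : ℤ) : 0 ≤ sdist p h :=
  (abs_nonneg _).trans (le_sdist hp h 0)

theorem sdist_zero (p : ℤ → ℝ) : sdist p 0 = 0 := by simp [sdist]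

theorem sdist_ap {p : ℤ → ℝ} (hp : AP p) : AP (sdist p) := by
  intro ε hε
  obtain ⟨K, hK, col, H⟩ := hp ε hε
  have hpb := hp.bdd
  refine ⟨K, hK, col, fun c c' hcc s => ?_⟩
  have key : ∀ c c', col c = col c' → sdist p (c + s) ≤ sdist p (c' + s) + ε := by
    intro c c' hcc
    apply ciSup_le
    intro t
    have h1 := le_sdist hpb (c' + s) t
    have h2 := H c c' hcc (s + t)
    have e1 : c + (s + t) = t + (c + s) := by ring
    have e2 : c' + (s + t) = t + (c' + s) := by ring
    rw [e1, e2] at h2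
    have h3 := abs_sub_le (p (t + (c + s))) (p (t + (c' + s))) (p t)
    linarith
  rw [abs_le]
  constructor
  · linarith [key c' c hcc.symm]
  · linarith [key c c' hcc]

theorem exists_kernel {M : Fn} (hM : IsMean M) (P : Finset {p // AP p}) {ε : ℝ} (hε : 0 < ε) :
    ∃ κ : ℤ → ℝ, AP κ ∧ (∀ n, 0 ≤ κ n) ∧ M κ = 1 ∧
      ∀ h, κ h ≠ 0 → ∀ p ∈ P, ∀ t, |p.1 (t + h) - p.1 t| ≤ ε := by
  let ρ : ℤ → ℝ := fun h => ∑ p ∈ P, sdist p.1 h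
  have hρ : AP ρ := AP.sum P (fun p _ => sdist_ap p.2)
  have hρ0 : ρ 0 = 0 := by simp [ρ, sdist_zero]
  let κ : ℤ → ℝ := fun h => max 0 (ε - ρ h)
  have hκ : AP κ := (AP.const 0).max ((AP.const ε).sub hρ)
  have hκ0 : ∀ n, 0 ≤ κ n := fun n => le_max_left _ _
  have hκb := hκ.bdd
  obtain ⟨K, _, col, r, hr⟩ := hρ.rep (half_pos hε)
  have hpos : 0 < M κ := by
    have h1 : ε / 2 ≤ M (fun c => ∑ k, κ (c + -(r k))) := by
      apply hM.const_le (by fun_prop)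
      intro c
      have h2 := hr c (-(r (col c)))
      rw [add_neg_cancel, hρ0, sub_zero] at h2
      have h3 := (le_abs_self _).trans h2
      have h4 : ε / 2 ≤ κ (c + -(r (col c))) := le_trans (by linarith) (le_max_right _ _)
      exact h4.trans (Finset.single_le_sum (f := fun k => κ (c + -(r k)))
        (fun k _ => hκ0 _) (Finset.mem_univ _))
    rw [Fn.sum] at h1
    have : ∀ k ∈ (Finset.univ : Finset K), M (fun c => κ (c + -(r k))) = M κ :=
      fun k _ => hM.shift κ _ hκb
    rw [Finset.sum_congr rfl this] at h1
    simp only [Finset.sum_const, nsmul_eq_mul] at h1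
    by_contra hn
    have := mul_nonpos_of_nonneg_of_nonpos (Nat.cast_nonneg (α := ℝ) (Finset.univ : Finset K).card)
      (not_lt.1 hn)
    linarith
  refine ⟨fun n => (M κ)⁻¹ * κ n, hκ.cmul _, fun n => mul_nonneg (inv_nonneg.2 hpos.le) (hκ0 n),
    ?_, ?_⟩
  · rw [Fn.cmul]; exact inv_mul_cancel₀ hpos.ne'
  · intro h hh p hp t
    have h1 : κ h ≠ 0 := right_ne_zero_of_mul hh
    have h2 : ρ h < ε := by
      by_contra hc
      exact h1 (max_eq_left (by linarith))
    refine (le_sdist p.2.bdd h t).trans ?_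
    refine le_trans ?_ h2.le
    exact Finset.single_le_sum (f := fun p : {p // AP p} => sdist p.1 h)
      (fun p _ => sdist_nonneg p.2.bdd h) hp

theorem exists_sys {M : Fn} (hM : IsMean M) {F : ℤ → ℤ → ℝ} {l k : ℤ}
    (hF0 : ∀ b n, 0 ≤ F b n) (hF1 : ∀ b n, F b n ≤ 1) (hl : 0 < l)
    (hFs : ∀ b n, F (b + l) n = F b (n + k)) :
    ∃ (G : Fn) (I : Type) (U : Filter I) (κ : I → ℤ → ℝ), Sys M G F l k U κ := by
  classical
  let I := Finset {p : ℤ → ℝ // AP p} × ℕ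
  have hne : (atTop : Filter I).NeBot := inferInstance
  let U : Ultrafilter I := Ultrafilter.of atTop
  have hU : (U : Filter I) ≤ atTop := Ultrafilter.of_le _
  have hk : ∀ i : I, ∃ κ : ℤ → ℝ, AP κ ∧ (∀ n, 0 ≤ κ n) ∧ M κ = 1 ∧
      ∀ h, κ h ≠ 0 → ∀ p ∈ i.1, ∀ t, |p.1 (t + h) - p.1 t| ≤ 1 / ((i.2 : ℝ) + 1) :=
    fun i => exists_kernel hM i.1 (by positivity)
  choose κ hκ hκ0 hκ1 hκl using hk
  have hFb : Bdd (fun z : ℤ × ℤ => F z.1 z.2) :=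
    ⟨1, fun z => by rw [abs_of_nonneg (hF0 _ _)]; exact hF1 _ _⟩
  have hFb1 : ∀ b, Bdd (fun n => F b n) := fun b => hFb.comp (fun n => (b, n))
  let T : I → Fn := fun i =>
    { toFun := fun η => M (fun b => M (fun n => η n * κ i (b - n) * F b n))
      map_add' := fun x y => by
        rw [← Fn.add]; congr 1; ext b; rw [← Fn.add]; congr 1; ext n; simp only [Pi.add_apply]; ring
      map_smul' := fun c x => by
        simp only [RingHom.id_apply, smul_eq_mul]
        rw [← Fn.cmul]; congr 1; ext b; rw [← Fn.cmul]; congr 1; ext n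
        simp only [Pi.smul_apply, smul_eq_mul]; ring }
  obtain ⟨G, hG⟩ := ultralim U T (by
    intro f hf
    obtain ⟨C, hC, hfC⟩ := hf.pos
    refine ⟨C * 2, fun i => ?_⟩
    have hκb := (hκ i).bdd
    have h1 := avg_bound hM zero_le_one (hM.dom.sup_bound hM) (hκ i) (hκ0 i) (hκ1 i)
      (V := fun n => C⁻¹ * f n) (fun n => by
        rw [abs_mul, abs_of_pos (inv_pos.2 hC), inv_mul_le_iff₀ hC, mul_one]
        exact hfC n) hF0 hF1
    have e : T i f = C * M (fun b => M (fun n => C⁻¹ * f n * κ i (b - n) * F b n)) := by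
      rw [← Fn.cmul]
      show M (fun b => M (fun n => f n * κ i (b - n) * F b n)) = _
      congr 1; ext b; rw [← Fn.cmul]; congr 1; ext n; field_simp
    rw [e, abs_mul, abs_of_pos hC]
    gcongr
    linarith)
  refine ⟨G, I, U, κ, ⟨hM, hF0, hF1, hl, hFs, inferInstance, hκ0, hκ, hκ1, ?_, hG⟩⟩
  intro p hp ε hε
  obtain ⟨j, hj⟩ := exists_nat_gt (1 / ε)
  apply hU
  filter_upwards [eventually_ge_atTop (({⟨p, hp⟩}, j) : I)] with i hi h hh t
  have h1 : (⟨p, hp⟩ : {p : ℤ → ℝ // AP p}) ∈ i.1 := hi.1 (Finset.mem_singleton_self _)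
  refine (hκl i h hh _ h1 t).trans ?_
  have h2 : (j : ℝ) ≤ i.2 := by exact_mod_cast hi.2
  rw [div_le_iff₀ (by positivity)]
  rw [div_lt_iff₀ hε] at hj
  nlinarith

/-- Recursive construction. -/
theorem Sys.build {M G : Fn} {F : ℤ → ℤ → ℝ} {l k : ℤ} {I : Type} {U : Filter I} {κ : I → ℤ → ℝ}
    (S : Sys M G F l k U κ) (hF01 : ∀ b n, F b n = 0 ∨ F b n = 1) {V : ℤ → ℝ}
    (hV : ∀ n, V n = 0 ∨ V n = 1) (hg : 0 < G V) :
    ∃ b : ℕ → ℤ, StrictMono b ∧ (∀ i, 0 < b i) ∧ (∀ i, V (b i) = 1) ∧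
      ∀ i j, i < j → F (b i) (b j) = 1 := by
  -- states: current set together with the last chosen element
  let St := {s : (ℤ → ℝ) × ℤ // (∀ n, s.1 n = 0 ∨ s.1 n = 1) ∧ 0 < G s.1}
  have step : ∀ s : St, ∃ s' : St, s.1.2 < s'.1.2 ∧ s.1.1 s'.1.2 = 1 ∧
      s'.1.1 = fun n => s.1.1 n * F s'.1.2 n := by
    rintro ⟨⟨W, B⟩, hW, hWg⟩
    obtain ⟨b, hb, hWb, hbg⟩ := S.main hW hWg B
    refine ⟨⟨(fun n => W n * F b n, b), ?_, hbg⟩, hb, hWb, rfl⟩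
    intro n
    have hWn : W n = 0 ∨ W n = 1 := hW n
    rcases hF01 b n with h' | h' <;> simp [h', hWn]
  choose nx hnx1 hnx2 hnx3 using step
  let s : ℕ → St := fun i => Nat.rec ⟨(V, 0), hV, hg⟩ (fun _ x => nx x) i
  have hs : ∀ i, s (i + 1) = nx (s i) := fun i => rfl
  let b : ℕ → ℤ := fun i => (s (i + 1)).1.2
  have hlt : ∀ i, (s i).1.2 < (s (i + 1)).1.2 := fun i => by rw [hs]; exact hnx1 _
  have hmono : StrictMono (fun i => (s i).1.2) := strictMono_nat_of_lt_succ hlt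
  have hW : ∀ i, (s i).1.1 (b i) = 1 := fun i => by simp only [b, hs]; exact hnx2 _
  have hrec : ∀ i n, (s (i + 1)).1.1 n = (s i).1.1 n * F (b i) n := by
    intro i n
    have := congrFun (hnx3 (s i)) n
    simpa only [b, hs] using this
  -- nested supports
  have hdec : ∀ i d n, (s (i + d)).1.1 n = 1 → (s i).1.1 n = 1 := by
    intro i d n
    induction d with
    | zero => exact id
    | succ d ih =>
      intro h
      apply ih
      have h2 := hrec (i + d) n
      rw [show i + (d + 1) = i + d + 1 by ring] at h
      rw [h] at h2
      rcases (s (i + d)).2.1 n with h3 | h3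
      · rw [h3] at h2; simp at h2
      · exact h3
  refine ⟨b, hmono.comp (strictMono_nat_of_lt_succ (fun i => Nat.lt_succ_self _)), ?_, ?_, ?_⟩
  · intro i
    exact hmono (Nat.succ_pos i)
  · intro i
    have := hdec 0 i (b i) (by rw [zero_add]; exact hW i)
    exact this
  · intro i j hij
    have h1 : (s (i + 1)).1.1 (b j) = 1 := by
      apply hdec (i + 1) (j - (i + 1))
      rw [show i + 1 + (j - (i + 1)) = j by omega]
      exact hW j
    rw [hrec] at h1
    rcases hF01 (b i) (b j) with h | h
    · rw [h] at h1; simp at h1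
    · exact h

end MBLB


namespace MBLB

theorem sum_inj (s T : Finset ℕ) (e : ℕ → ℕ) (f g : ℕ → ℝ) (hmap : ∀ t ∈ s, e t ∈ T)
    (hinj : ∀ t ∈ s, ∀ t' ∈ s, e t = e t' → t = t') (hfg : ∀ t ∈ s, f t ≤ g (e t))
    (hg : ∀ j, 0 ≤ g j) : ∑ t ∈ s, f t ≤ ∑ j ∈ T, g j := by
  classical
  calc ∑ t ∈ s, f t ≤ ∑ t ∈ s, g (e t) := Finset.sum_le_sum hfg
    _ = ∑ j ∈ s.image e, g j := (Finset.sum_image (fun x hx y hy h => hinj x hx y hy h)).symm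
    _ ≤ ∑ j ∈ T, g j := by
      apply Finset.sum_le_sum_of_subset_of_nonneg
      · intro j hj
        obtain ⟨t, ht, rfl⟩ := Finset.mem_image.1 hj
        exact hmap t ht
      · intro j _ _; exact hg j

theorem exists_mean {I : Type} (u : Ultrafilter I) (K : I → ℕ) (hK : Tendsto K u atTop) :
    ∃ M : Fn, IsMean M ∧ ∀ f : ℤ → ℝ, Bdd f →
      Tendsto (fun i => (K i : ℝ)⁻¹ * ∑ t ∈ Finset.range (K i), f (1 + (t : ℤ))) u (𝓝 (M f)) := by
  let T : I → Fn := fun i =>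
    { toFun := fun f => (K i : ℝ)⁻¹ * ∑ t ∈ Finset.range (K i), f (1 + (t : ℤ))
      map_add' := fun x y => by simp [Finset.sum_add_distrib, mul_add]
      map_smul' := fun c x => by
        simp only [Pi.smul_apply, smul_eq_mul, RingHom.id_apply, ← Finset.mul_sum]; ring }
  have hTb : ∀ f C, 0 ≤ C → (∀ n, |f n| ≤ C) → ∀ i, |T i f| ≤ C := by
    intro f C hC0 hC i
    show |(K i : ℝ)⁻¹ * ∑ t ∈ Finset.range (K i), f (1 + t)| ≤ C
    rw [abs_mul, abs_of_nonneg (by positivity)]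
    have h1 : |∑ t ∈ Finset.range (K i), f (1 + t)| ≤ K i * C := by
      refine (Finset.abs_sum_le_sum_abs _ _).trans ?_
      refine (Finset.sum_le_sum (fun t _ => hC _)).trans ?_
      simp
    rcases Nat.eq_zero_or_pos (K i) with h | h
    · simp [h, hC0]
    · have : (0 : ℝ) < K i := by exact_mod_cast h
      rw [inv_mul_le_iff₀ this]
      exact h1
  obtain ⟨M, hM⟩ := ultralim u T (fun f hf => by
    obtain ⟨C, hC0, hC⟩ := hf.pos
    exact ⟨C, hTb f C hC0.le hC⟩)
  have hKr : Tendsto (fun i => (K i : ℝ)⁻¹) u (𝓝 0) :=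
    (tendsto_inv_atTop_zero.comp tendsto_natCast_atTop_atTop).comp hK
  have hshn : ∀ (f : ℤ → ℝ) (h : ℕ), Bdd f → M (fun n => f (n + h)) = M f := by
    intro f h hf
    obtain ⟨C, hC0, hC⟩ := hf.pos
    have h1 := (hM (fun n => f (n + h)) (by fun_prop)).sub (hM f hf)
    have h2 : Tendsto (fun i => T i (fun n => f (n + h)) - T i f) u (𝓝 0) := by
      have h3 : Tendsto (fun i => (K i : ℝ)⁻¹ * (2 * h * C)) u (𝓝 0) := by
        simpa using hKr.mul_const (2 * h * C)
      apply squeeze_zero_norm _ h3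
      intro i
      show ‖(K i : ℝ)⁻¹ * ∑ t ∈ Finset.range (K i), f (1 + t + h) -
        (K i : ℝ)⁻¹ * ∑ t ∈ Finset.range (K i), f (1 + t)‖ ≤ _
      rw [← mul_sub, Real.norm_eq_abs, abs_mul, abs_of_nonneg (by positivity)]
      gcongr
      have := sum_shift_bound hC (K i) h 1
      have e : ∀ t : ℕ, (1 : ℤ) + t + h = 1 + h + t := fun t => by ring
      simp only [e]
      exact this
    have := tendsto_nhds_unique h1 h2
    linarith
  refine ⟨M, ⟨?_, ?_, ?_, ?_⟩, hM⟩
  · intro f hf h0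
    refine ge_of_tendsto' (hM f hf) (fun i => ?_)
    exact mul_nonneg (by positivity) (Finset.sum_nonneg (fun t _ => h0 _))
  · have h1 := hM (fun _ => 1) (bdd_const 1)
    refine tendsto_nhds_unique h1 (tendsto_const_nhds.congr' ?_)
    filter_upwards [hK.eventually (eventually_gt_atTop 0)] with i hi
    have : (0 : ℝ) < K i := by exact_mod_cast hi
    show (1 : ℝ) = (K i : ℝ)⁻¹ * ∑ t ∈ Finset.range (K i), 1
    simp [this.ne']
  · intro f h hf
    obtain ⟨j, rfl | rfl⟩ := Int.eq_nat_or_neg h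
    · exact hshn f j hf
    · have := hshn (fun n => f (n + -(j : ℤ))) j (by fun_prop)
      rw [← this]
      congr 1; ext n; congr 1; ring
  · intro f B hf hB
    rw [← hshn f B.toNat hf]
    refine tendsto_nhds_unique (hM (fun n => f (n + B.toNat)) (by fun_prop))
      (tendsto_const_nhds.congr ?_)
    intro i
    show 0 = (K i : ℝ)⁻¹ * ∑ t ∈ Finset.range (K i), f (1 + t + B.toNat)
    rw [Finset.sum_eq_zero, mul_zero]
    intro t _
    apply hB
    omega

/-- mean along multiples of `l` -/
noncomputable def Fn.dil (M : Fn) (l : ℤ) : Fn where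
  toFun f := M (fun s => if l ∣ s then (l : ℝ) * f (s / l) else 0)
  map_add' x y := by
    rw [← Fn.add]; congr 1; ext s; split_ifs <;> simp [mul_add]
  map_smul' c x := by
    simp only [RingHom.id_apply, smul_eq_mul]
    rw [← Fn.cmul]; congr 1; ext s; split_ifs <;> simp [mul_left_comm]

theorem dil_bdd (l : ℤ) {f : ℤ → ℝ} (hf : Bdd f) :
    Bdd (fun s => if l ∣ s then (l : ℝ) * f (s / l) else 0) := by
  obtain ⟨C, hC0, hC⟩ := hf.pos
  refine ⟨|(l : ℝ)| * C, fun s => ?_⟩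
  dsimp only
  split_ifs
  · rw [abs_mul]; gcongr; exact hC _
  · simp; positivity

theorem dil_mean {M : Fn} (hM : IsMean M) {l : ℤ} (hl : 0 < l) : IsMean (M.dil l) := by
  have hlr : (0 : ℝ) < l := by exact_mod_cast hl
  refine ⟨?_, ?_, ?_, ?_⟩
  · intro f hf h0
    apply hM.nonneg _ (dil_bdd l hf)
    intro s
    split_ifs
    · exact mul_nonneg hlr.le (h0 _)
    · exact le_rfl
  · have hb : Bdd (fun s : ℤ => if l ∣ s then (1 : ℝ) else 0) :=
      ⟨1, fun s => by dsimp only; split_ifs <;> simp⟩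
    have h1 : M (fun s : ℤ => ∑ j ∈ Finset.range l.toNat, (if l ∣ s + j then (1 : ℝ) else 0)) = 1 := by
      have e : (fun s : ℤ => ∑ j ∈ Finset.range l.toNat, (if l ∣ s + j then (1 : ℝ) else 0)) =
          fun _ => 1 := by
       ext s
       have hm0 := Int.emod_nonneg (-s) hl.ne'
       have hm1 := Int.emod_lt_of_pos (-s) hl
       have hdm := Int.emod_add_mul_ediv (-s) l
       rw [Finset.sum_eq_single ((-s) % l).toNat]
       · rw [if_pos]
         rw [Int.toNat_of_nonneg hm0]
         refine ⟨-((-s) / l), ?_⟩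
         linarith
       · intro j hj hne
         rw [if_neg]
         rintro ⟨c, hc⟩
         apply hne
         have hj := Finset.mem_range.1 hj
         have : (j : ℤ) = (-s) % l := by
           have e : (-s) = j + l * (-c) := by linarith
           rw [e, Int.add_mul_emod_self_left, Int.emod_eq_of_lt (by omega) (by omega)]
         omega
       · intro h
         exfalso; apply h
         rw [Finset.mem_range]; omega
      rw [e, hM.one]
    rw [Fn.sum] at h1
    have h2 : ∀ j ∈ Finset.range l.toNat, M (fun s => if l ∣ s + (j : ℤ) then (1 : ℝ) else 0) =
      M (fun s => if l ∣ s then (1 : ℝ) else 0) := fun j _ =>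
      hM.shift (fun s => if l ∣ s then (1 : ℝ) else 0) j hb
    rw [Finset.sum_congr rfl h2] at h1
    simp only [Finset.sum_const, Finset.card_range, nsmul_eq_mul] at h1
    have h3 : ((l.toNat : ℕ) : ℝ) = l := by
      have : ((l.toNat : ℕ) : ℤ) = l := Int.toNat_of_nonneg hl.le
      exact_mod_cast this
    rw [h3, ← Fn.cmul] at h1
    refine Eq.trans ?_ h1
    show M _ = M _
    congr 1; ext s; split_ifs <;> simp
  · intro f h hf
    have := hM.shift _ (l * h) (dil_bdd l hf)
    show M _ = M _
    rw [← this]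
    congr 1; ext s
    have e1 : l ∣ s + l * h ↔ l ∣ s := (Int.dvd_add_left (Dvd.intro h rfl))
    rw [Int.add_mul_ediv_left _ _ hl.ne']
    simp only [e1]
  · intro f B hf hB
    apply hM.tail _ (l * B + l) (dil_bdd l hf)
    intro s hs
    split_ifs with hd
    · obtain ⟨c, rfl⟩ := hd
      rw [Int.mul_ediv_cancel_left _ hl.ne', hB, mul_zero]
      nlinarith
    · rfl

theorem count_bound {l m s b : ℤ} (hl : 0 < l) (hm : 0 < m) (R : ℕ) {κ : ℤ → ℝ}
    (hκ0 : ∀ n, 0 ≤ κ n) :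
    ∑ t ∈ Finset.range (l.toNat * R), (if l ∣ s - m * (b + t) then
      κ (b + t - (s - m * (b + t)) / l) else 0) ≤
    ∑ j ∈ Finset.range ((l + m).toNat * R), κ (-((s - (l + m) * b) / l) + j) := by
  rw [← Finset.sum_filter]
  have hr0 := Int.emod_nonneg (s - (l + m) * b) hl.ne'
  have hr1 := Int.emod_lt_of_pos (s - (l + m) * b) hl
  have hdm := Int.emod_add_mul_ediv (s - (l + m) * b) l
  set r := (s - (l + m) * b) % l
  set d := (s - (l + m) * b) / l
  have hlN : ((l.toNat : ℕ) : ℤ) = l := Int.toNat_of_nonneg hl.le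
  have hqN : (((l + m).toNat : ℕ) : ℤ) = l + m := Int.toNat_of_nonneg (by omega)
  -- the index of the translate
  have key : ∀ t : ℕ, t ∈ (Finset.range (l.toNat * R)).filter (fun t : ℕ => l ∣ s - m * (b + t)) →
      0 ≤ (b + t - (s - m * (b + t)) / l) + d ∧
      l * ((b + t - (s - m * (b + t)) / l) + d) = (l + m) * t - r ∧ (t : ℤ) < l * R := by
    intro t ht
    rw [Finset.mem_filter, Finset.mem_range] at ht
    obtain ⟨ht, c, hc⟩ := ht
    rw [hc, Int.mul_ediv_cancel_left _ hl.ne']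
    have h1 : l * ((b + t - c) + d) = (l + m) * t - r := by linarith
    have h2 : (t : ℤ) < l * R := by
      have : ((t : ℕ) : ℤ) < ((l.toNat * R : ℕ) : ℤ) := by exact_mod_cast ht
      rwa [Nat.cast_mul, hlN] at this
    refine ⟨?_, h1, h2⟩
    by_contra hneg
    have h3 : (b + t - c) + d ≤ -1 := by omega
    have h4 : l * ((b + t - c) + d) ≤ l * (-1) := mul_le_mul_of_nonneg_left h3 hl.le
    have h5 : 0 ≤ (l + m) * (t : ℤ) := by positivity
    linarith
  apply sum_inj _ _ (fun t : ℕ => ((b + t - (s - m * (b + t)) / l) + d).toNat)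
  · intro t ht
    obtain ⟨h1, h2, h3⟩ := key t ht
    rw [Finset.mem_range]
    have h4 : (b + t - (s - m * (b + t)) / l) + d < (l + m) * R := by
      by_contra hcon
      push Not at hcon
      have h5 := mul_le_mul_of_nonneg_left hcon hl.le
      have h6 : (l + m) * (t : ℤ) < (l + m) * (l * R) := mul_lt_mul_of_pos_left h3 (by omega)
      rw [h2] at h5
      nlinarith
    zify
    rw [Int.toNat_of_nonneg h1, hqN]
    exact h4
  · intro t ht t' ht' he
    obtain ⟨h1, h2, h3⟩ := key t ht
    obtain ⟨h1', h2', h3'⟩ := key t' ht'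
    have he' : (b + t - (s - m * (b + t)) / l) + d = (b + t' - (s - m * (b + t')) / l) + d := by
      have he2 : ((b + t - (s - m * (b + t)) / l) + d).toNat = ((b + t' - (s - m * (b + t')) / l) + d).toNat := he
      omega
    rw [he', h2'] at h2
    have h4 : (l + m) * (t' : ℤ) = (l + m) * t := by linarith
    have := mul_left_cancel₀ (by omega : l + m ≠ 0) h4
    omega
  · intro t ht
    obtain ⟨h1, h2, h3⟩ := key t ht
    rw [Int.toNat_of_nonneg h1]
    apply le_of_eq; congr 1; ring
  · intro j; exact hκ0 _

theorem gamma_bound {M : Fn} (hM : IsMean M) {l m : ℤ} (hl : 0 < l) (hm : 0 < m) {κ : ℤ → ℝ}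
    (hκ : AP κ) (hκ0 : ∀ n, 0 ≤ κ n) (hκ1 : M.dil l κ = 1) {a : ℤ → ℝ} (ha : Bdd a)
    (ha0 : ∀ n, 0 ≤ a n) :
    M.dil l (fun b => M.dil l (fun n => κ (b - n) * a (l * n + m * b))) ≤ (l + m) * M a := by
  have hM' := dil_mean hM hl
  have hκb := hκ.bdd
  have hlr : (0 : ℝ) < l := by exact_mod_cast hl
  have hmr : (0 : ℝ) < m := by exact_mod_cast hm
  have hMa : 0 ≤ M a := hM.nonneg a ha ha0
  have key : ∀ ε : ℝ, 0 < ε → M.dil l (fun b => M.dil l (fun n => κ (b - n) * a (l * n + m * b)))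
      ≤ (1 + ε) * ((l + m) * M a) := by
    intro ε hε
    obtain ⟨R, hR, hk⟩ := kavg hM' hκ hκ1 hε
    have hL : 0 < l.toNat * R := Nat.mul_pos (by omega) hR
    have hlN : ((l.toNat : ℕ) : ℝ) = l := by
      have : ((l.toNat : ℕ) : ℤ) = l := Int.toNat_of_nonneg hl.le
      exact_mod_cast this
    have hqN : (((l + m).toNat : ℕ) : ℝ) = l + m := by
      have : (((l + m).toNat : ℕ) : ℤ) = l + m := Int.toNat_of_nonneg (by omega)
      exact_mod_cast this
    have hRr : (0 : ℝ) < R := by exact_mod_cast hR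
    rw [slide hM' (hM'.dom.sup_bound hM') (Φ := fun b n => κ (b - n) * a (l * n + m * b))
      (by fun_prop) hL]
    apply hM'.le_const
    · exact hM'.dom.bdd_inner hM' (F := fun b n => ((l.toNat * R : ℕ) : ℝ)⁻¹ *
        ∑ t ∈ Finset.range (l.toNat * R), κ (b + t - n) * a (l * n + m * (b + t))) (by fun_prop)
    intro b
    rw [Fn.cmul, Fn.sum]
    have h1 : ∀ t ∈ Finset.range (l.toNat * R),
        M.dil l (fun n => κ (b + t - n) * a (l * n + m * (b + t))) =
        M (fun s => if l ∣ s - m * (b + t) then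
          (l * a s) * κ (b + t - (s - m * (b + t)) / l) else 0) := by
      intro t _
      have hb := dil_bdd l (f := fun n => κ (b + t - n) * a (l * n + m * (b + t))) (by fun_prop)
      have h2 := hM.shift _ (-(m * (b + t))) hb
      show M _ = _
      rw [← h2]
      congr 1; ext s
      rw [← sub_eq_add_neg]
      split_ifs with hd
      · rw [Int.mul_ediv_cancel' hd, sub_add_cancel]; ring
      · rfl
    rw [Finset.sum_congr rfl h1, ← Fn.sum, Nat.cast_mul, hlN, inv_mul_le_iff₀ (by positivity)]
    have h3 : M (fun s => ∑ t ∈ Finset.range (l.toNat * R), if l ∣ s - m * (b + t) then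
          (l * a s) * κ (b + t - (s - m * (b + t)) / l) else 0) ≤
        M (fun s => (l * ((1 + ε) * ((l + m) * R))) * a s) := by
      apply hM.dom.mono
      · apply bdd_sum
        intro t
        obtain ⟨C, hC⟩ := (show Bdd (fun s => (l * a s) *
          κ (b + t - (s - m * (b + t)) / l)) by fun_prop)
        refine ⟨C, fun s => ?_⟩
        dsimp only
        split_ifs
        · exact hC s
        · simpa using (abs_nonneg _).trans (hC s)
      · fun_prop
      · intro s
        have h4 := count_bound (s := s) (b := b) hl hm R hκ0
        have h5 : ∑ t ∈ Finset.range (l.toNat * R), (if l ∣ s - m * (b + t) then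
          (l * a s) * κ (b + t - (s - m * (b + t)) / l) else 0) =
          (l * a s) * ∑ t ∈ Finset.range (l.toNat * R), (if l ∣ s - m * (b + t) then
          κ (b + t - (s - m * (b + t)) / l) else 0) := by
          rw [Finset.mul_sum]; apply Finset.sum_congr rfl; intro t _; split_ifs <;> simp
        have h6 := (abs_le.1 (hk ((l + m).toNat * R)
          (Nat.le_mul_of_pos_left R (by omega)) (-((s - (l + m) * b) / l)))).2
        rw [Nat.cast_mul, hqN, sub_le_iff_le_add, inv_mul_le_iff₀ (by positivity)] at h6
        rw [h5]
        calc _ ≤ (l * a s) * ((l + m) * R * (ε + 1)) := by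
              apply mul_le_mul_of_nonneg_left (h4.trans h6) (mul_nonneg hlr.le (ha0 s))
          _ = _ := by ring
    rw [Fn.cmul] at h3
    calc _ ≤ _ := h3
      _ = _ := by ring
  have hq : 0 ≤ ((l : ℝ) + m) * M a := by positivity
  refine le_of_forall_pos_le_add (fun ε hε => ?_)
  refine (key (ε / ((l + m) * M a + 1)) (by positivity)).trans ?_
  have : ε / ((l + m) * M a + 1) * ((l + m) * M a) ≤ ε := by
    rw [div_mul_eq_mul_div, div_le_iff₀ (by positivity)]
    nlinarith
  linarith

end MBLB


namespace MBLB

open scoped Classical in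
/-- indicator of `A` on the integers -/
noncomputable def ind (A : Set ℕ) (n : ℤ) : ℝ := if 0 < n ∧ n.toNat ∈ A then 1 else 0

theorem ind_01 (A : Set ℕ) (n : ℤ) : ind A n = 0 ∨ ind A n = 1 := by
  unfold ind; split_ifs <;> simp

theorem ind_nonneg (A : Set ℕ) (n : ℤ) : 0 ≤ ind A n := by
  rcases ind_01 A n with h | h <;> rw [h]
  exact zero_le_one

theorem ind_le (A : Set ℕ) (n : ℤ) : ind A n ≤ 1 := by
  rcases ind_01 A n with h | h <;> rw [h]
  exact zero_le_one

theorem ind_bdd (A : Set ℕ) : Bdd (ind A) :=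
  ⟨1, fun n => by rw [abs_of_nonneg (ind_nonneg A n)]; exact ind_le A n⟩

theorem ind_mem {A : Set ℕ} {n : ℤ} (h : ind A n = 1) : n.toNat ∈ A := by
  unfold ind at h
  split_ifs at h with h1
  · exact h1.2
  · norm_num at h

open scoped Classical in
theorem sum_ind (A : Set ℕ) (N : ℕ) :
    ∑ t ∈ Finset.range N, ind A (1 + (t : ℤ)) = (((Finset.Icc 1 N).filter (· ∈ A)).card : ℝ) := by
  induction N with
  | zero => simp
  | succ N ih =>
    rw [Finset.sum_range_succ, ih, ← Finset.insert_Icc_right_eq_Icc_add_one (by omega),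
      Finset.filter_insert]
    have e : (1 + (N : ℤ)).toNat = N + 1 := by omega
    unfold ind
    rw [e]
    by_cases h : N + 1 ∈ A
    · rw [if_pos ⟨by omega, h⟩, if_pos h, Finset.card_insert_of_notMem (by simp)]
      push_cast; ring
    · rw [if_neg (fun h' => h h'.2), if_neg h, add_zero]

theorem sum_ind_compl (A : Set ℕ) (N : ℕ) :
    ∑ t ∈ Finset.range N, (1 - ind A (1 + (t : ℤ))) =
      N - ∑ t ∈ Finset.range N, ind A (1 + (t : ℤ)) := by
  rw [Finset.sum_sub_distrib]; simp

/-- sampling along multiples of `q` -/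
theorem sample_bound (A : Set ℕ) {l q : ℕ} (hl : 0 < l) (hq : 0 < q) (N' : ℕ) :
    ∑ t ∈ Finset.range (l * (N' / q)), (if (l : ℤ) ∣ 1 + (t : ℤ) then
      ((l : ℤ) : ℝ) * (1 - ind A (q * ((1 + (t : ℤ)) / l))) else 0) ≤
    l * (N' - ∑ t ∈ Finset.range N', ind A (1 + (t : ℤ))) := by
  rw [← sum_ind_compl, Finset.mul_sum, ← Finset.sum_filter]
  have key : ∀ t ∈ (Finset.range (l * (N' / q))).filter (fun t : ℕ => (l : ℤ) ∣ 1 + (t : ℤ)),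
      ∃ c : ℕ, 1 + t = l * c ∧ 0 < c ∧ c ≤ N' / q ∧ (1 + (t : ℤ)) / l = c := by
    intro t ht
    rw [Finset.mem_filter, Finset.mem_range] at ht
    obtain ⟨ht, hd⟩ := ht
    have hd : l ∣ 1 + t := by exact_mod_cast hd
    obtain ⟨c, hc⟩ := hd
    refine ⟨c, hc, ?_, ?_, ?_⟩
    · rcases Nat.eq_zero_or_pos c with h | h
      · subst h; omega
      · exact h
    · have : l * c ≤ l * (N' / q) := by omega
      exact Nat.le_of_mul_le_mul_left this hl
    · have : (1 + (t : ℤ)) = l * c := by exact_mod_cast hc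
      rw [this, Int.mul_ediv_cancel_left _ (by exact_mod_cast hl.ne')]
  apply sum_inj _ _ (fun t : ℕ => q * ((1 + t) / l) - 1)
  · intro t ht
    obtain ⟨c, h1, h2, h3, h4⟩ := key t ht
    rw [Finset.mem_range, h1, Nat.mul_div_cancel_left _ hl]
    have := Nat.mul_le_mul_left q h3
    have h5 := Nat.mul_div_le N' q
    have h6 := Nat.mul_pos hq h2
    omega
  · intro t ht t' ht' he
    obtain ⟨c, h1, h2, h3, h4⟩ := key t ht
    obtain ⟨c', h1', h2', h3', h4'⟩ := key t' ht'
    have he2 : q * ((1 + t) / l) - 1 = q * ((1 + t') / l) - 1 := he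
    rw [h1, h1', Nat.mul_div_cancel_left _ hl, Nat.mul_div_cancel_left _ hl] at he2
    have h6 := Nat.mul_pos hq h2
    have h6' := Nat.mul_pos hq h2'
    have : q * c = q * c' := by omega
    have := Nat.eq_of_mul_eq_mul_left hq this
    subst this
    omega
  · intro t ht
    obtain ⟨c, h1, h2, h3, h4⟩ := key t ht
    have h6 := Nat.mul_pos hq h2
    rw [h4, h1, Nat.mul_div_cancel_left _ hl]
    have : (1 : ℤ) + ((q * c - 1 : ℕ) : ℤ) = q * c := by
      rw [Nat.cast_sub h6]; push_cast; ring
    rw [this]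
    simp
  · intro j
    exact mul_nonneg (by positivity) (sub_nonneg.2 (ind_le _ _))

theorem core (A : Set ℕ) {l m : ℕ} (hl : 0 < l) (hm : 0 < m) {α β : ℝ}
    (hα : ∀ᶠ N : ℕ in atTop, α ≤ (∑ t ∈ Finset.range N, ind A (1 + (t : ℤ))) / N)
    (hβ : ∃ᶠ N : ℕ in atTop, β ≤ (∑ t ∈ Finset.range N, ind A (1 + (t : ℤ))) / N)
    (h : (l + m : ℝ) * ((1 - α) + (1 - β)) < 1) :
    ∃ B : Set ℕ, B.Infinite ∧ ∀ b₁ ∈ B, ∀ b₂ ∈ B, b₁ ≤ b₂ → m * b₁ + l * b₂ ∈ A := by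
  have hlr : (0 : ℝ) < l := by exact_mod_cast hl
  have hmr : (0 : ℝ) < m := by exact_mod_cast hm
  have hlz : (0 : ℤ) < l := by exact_mod_cast hl
  have hmz : (0 : ℤ) < m := by exact_mod_cast hm
  have hab := ind_bdd A
  have hcb : Bdd (fun n => 1 - ind A n) := by fun_prop
  have hc0 : ∀ n, 0 ≤ 1 - ind A n := fun n => sub_nonneg.2 (ind_le A n)
  have hne : (atTop ⊓ 𝓟 {N : ℕ | β ≤ (∑ t ∈ Finset.range N, ind A (1 + (t : ℤ))) / N}).NeBot :=
    frequently_mem_iff_neBot.1 hβ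
  let u : Ultrafilter ℕ := Ultrafilter.of
    (atTop ⊓ 𝓟 {N : ℕ | β ≤ (∑ t ∈ Finset.range N, ind A (1 + (t : ℤ))) / N})
  have hu : (u : Filter ℕ) ≤ atTop ⊓ 𝓟 {N : ℕ | β ≤ (∑ t ∈ Finset.range N, ind A (1 + (t : ℤ))) / N} :=
    Ultrafilter.of_le _
  have hu1 : (u : Filter ℕ) ≤ atTop := hu.trans inf_le_left
  have hu2 : ∀ᶠ N : ℕ in (u : Filter ℕ), β ≤ (∑ t ∈ Finset.range N, ind A (1 + (t : ℤ))) / N :=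
    (hu.trans inf_le_right) (mem_principal_self _)
  have hdiv : Tendsto (fun N : ℕ => N / (l + m)) u atTop :=
    (Nat.tendsto_div_const_atTop (by omega)).mono_left hu1
  have hK : Tendsto (fun N : ℕ => l * (N / (l + m))) u atTop := by
    refine tendsto_atTop_mono (fun N => ?_) hdiv
    exact Nat.le_mul_of_pos_left _ hl
  obtain ⟨M, hM, hlim⟩ := exists_mean u _ hK
  have hM' := dil_mean hM hlz
  -- the lower density bound
  have hMc : M (fun n => 1 - ind A n) ≤ 1 - α := by
    refine le_of_tendsto (hlim _ hcb) ?_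
    filter_upwards [hK.eventually hα, hK.eventually (eventually_gt_atTop 0)] with N h1 h2
    rw [sum_ind_compl]
    have : (0 : ℝ) < (l * (N / (l + m)) : ℕ) := by exact_mod_cast h2
    rw [le_div_iff₀ this] at h1
    rw [inv_mul_le_iff₀ this]
    linarith
  -- the upper density bound
  have hMV : M.dil l (fun n => 1 - ind A ((l + m : ℕ) * n)) ≤ (l + m) * (1 - β) := by
    have hb := dil_bdd (l : ℤ) (f := fun n => 1 - ind A ((l + m : ℕ) * n)) (by fun_prop)
    have h0 : Tendsto (fun N : ℕ => (1 - β) * ((l + m) + (l + m) * ((N / (l + m) : ℕ) : ℝ)⁻¹)) u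
        (𝓝 ((1 - β) * ((l + m) + (l + m) * 0))) := by
      apply Tendsto.const_mul
      apply Tendsto.const_add
      apply Tendsto.const_mul
      exact (tendsto_inv_atTop_zero.comp tendsto_natCast_atTop_atTop).comp hdiv
    have h1 := le_of_tendsto_of_tendsto (hlim _ hb) h0 (by
      filter_upwards [hu2, hdiv.eventually (eventually_gt_atTop 0)] with N h1 h2
      have h3 := sample_bound A hl (by omega : 0 < l + m) N
      have h2r : (0 : ℝ) < (N / (l + m) : ℕ) := by exact_mod_cast h2
      have hN : 0 < N := by
        rcases Nat.eq_zero_or_pos N with h | h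
        · subst h; simp at h2
        · exact h
      have hNr : (0 : ℝ) < N := by exact_mod_cast hN
      have hs1 : (∑ t ∈ Finset.range N, ind A (1 + (t : ℤ))) ≤ N := by
        refine (Finset.sum_le_sum (fun t _ => ind_le A _)).trans ?_
        simp
      have hβ1 : β ≤ 1 := h1.trans ((div_le_one hNr).2 hs1)
      rw [le_div_iff₀ hNr] at h1
      have h4 : (N : ℝ) ≤ (l + m) * ((N / (l + m) : ℕ) + 1) := by
        have : N ≤ (l + m) * (N / (l + m) + 1) := (Nat.lt_mul_div_succ N (by omega)).le
        exact_mod_cast this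
      refine (mul_le_mul_of_nonneg_left h3 (by positivity)).trans ?_
      rw [Nat.cast_mul, inv_mul_le_iff₀ (by positivity)]
      calc (l : ℝ) * (N - ∑ t ∈ Finset.range N, ind A (1 + (t : ℤ))) ≤ l * ((1 - β) * N) := by
            apply mul_le_mul_of_nonneg_left _ hlr.le; linarith
        _ ≤ l * ((1 - β) * ((l + m) * ((N / (l + m) : ℕ) + 1))) := by
            apply mul_le_mul_of_nonneg_left _ hlr.le
            exact mul_le_mul_of_nonneg_left h4 (by linarith)
        _ = _ := by field_simp)
    have h2 : (1 - β) * ((l + m : ℝ) + (l + m) * 0) = (l + m) * (1 - β) := by ring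
    rw [h2] at h1
    exact h1
  obtain ⟨G, I, U, κ, S⟩ := exists_sys hM' (F := fun b n => ind A (l * n + m * b)) (l := l) (k := m)
    (fun b n => ind_nonneg A _) (fun b n => ind_le A _) hlz (fun b n => by
      show ind A _ = ind A _
      congr 1; ring)
  have hUne := S.ne
  have hG1 : 1 - (l + m) * (1 - α) ≤ G (fun _ => 1) := by
    refine ge_of_tendsto' (S.lim (fun _ => 1) (bdd_const 1)) (fun i => ?_)
    have hκb := (S.kap i).bdd
    have h1 := avg_eq hM' zero_le_one (hM'.dom.sup_bound hM') (S.kap i) (S.k1 i)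
      (η := fun _ => 1) (bdd_const 1)
    rw [hM'.one] at h1
    have h2 := gamma_bound hM hlz hmz (S.kap i) (S.k0 i) (S.k1 i) hcb hc0
    have h3 : (M.dil l) (fun b => (M.dil l) (fun n => 1 * κ i (b - n) * ind A (l * n + m * b))) =
        (M.dil l) (fun b => (M.dil l) (fun n => 1 * κ i (b - n))) -
        (M.dil l) (fun b => (M.dil l) (fun n => κ i (b - n) * (1 - ind A (l * n + m * b)))) := by
      rw [← Fn.sub]
      congr 1; ext b
      rw [← Fn.sub]
      congr 1; ext n
      ring
    rw [h3, h1]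
    have h4 := mul_le_mul_of_nonneg_left hMc (by positivity : (0 : ℝ) ≤ l + m)
    push_cast at h2
    linarith
  have hGV : 0 < G (fun n => ind A ((l + m : ℕ) * n)) := by
    have h1 := S.dom.le (fun n => 1 - ind A ((l + m : ℕ) * n)) (by fun_prop) (fun n => hc0 _)
    rw [Fn.sub] at h1
    linarith
  obtain ⟨b, hb, hpos, hV, hF⟩ := S.build (fun b n => ind_01 A _) (fun n => ind_01 A _) hGV
  have hmono : StrictMono (fun i => (b i).toNat) := by
    intro i j hij
    have := hb hij
    have := hpos i
    have := hpos j
    show (b i).toNat < (b j).toNat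
    omega
  refine ⟨Set.range (fun i => (b i).toNat), Set.infinite_range_of_injective hmono.injective, ?_⟩
  rintro _ ⟨i, rfl⟩ _ ⟨j, rfl⟩ hij
  have hij : i ≤ j := hmono.le_iff_le.1 hij
  have hi : ((b i).toNat : ℤ) = b i := Int.toNat_of_nonneg (hpos i).le
  have hj : ((b j).toNat : ℤ) = b j := Int.toNat_of_nonneg (hpos j).le
  rcases hij.eq_or_lt with rfl | hlt
  · have := ind_mem (hV i)
    convert this using 1
    zify
    have h9 : (0 : ℤ) ≤ ((l + m : ℕ) : ℤ) * b i := by have := hpos i; positivity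
    have h8 := Int.toNat_of_nonneg h9
    push_cast at h8 ⊢
    rw [h8, hi]
    ring
  · have := ind_mem (hF i j hlt)
    convert this using 1
    zify
    have h9 : (0 : ℤ) ≤ l * b j + m * b i := by have := hpos i; have := hpos j; positivity
    rw [Int.toNat_of_nonneg h9, hi, hj]
    ring

end MBLB

/-- If `d_(A) + d̄(A) > 2 - 1/(ℓ+m)`, there exists an infinite `B ⊆ ℕ` with
`{m b₁ + ℓ b₂ : b₁, b₂ ∈ B, b₁ ≤ b₂} ⊆ A`. -/
theorem mB_add_lB_diag_mixed_density_unshifted (ℓ m : ℕ) (hℓ : 0 < ℓ) (hm : 0 < m)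
    (A : Set ℕ) (hA : lowerDensity A + upperDensity A > 2 - 1 / ((ℓ : ℝ) + m)) :
    ∃ B : Set ℕ, B.Infinite ∧
      ∀ b₁ ∈ B, ∀ b₂ ∈ B, b₁ ≤ b₂ → m * b₁ + ℓ * b₂ ∈ A := by
  classical
  have hq : (0 : ℝ) < (ℓ : ℝ) + m := by positivity
  have h0 : ∀ N : ℕ, 0 ≤ (((Finset.Icc 1 N).filter (· ∈ A)).card : ℝ) / N := fun N => by positivity
  have h1 : ∀ N : ℕ, (((Finset.Icc 1 N).filter (· ∈ A)).card : ℝ) / N ≤ 1 := fun N => by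
    apply div_le_one_of_le₀ _ (by positivity)
    have := Finset.card_filter_le (Finset.Icc 1 N) (· ∈ A)
    rw [Nat.card_Icc] at this
    exact_mod_cast this
  obtain ⟨δ, hδ, hsum⟩ : ∃ δ : ℝ, 0 < δ ∧
      2 - 1 / ((ℓ : ℝ) + m) < (lowerDensity A - δ) + (upperDensity A - δ) :=
    ⟨(lowerDensity A + upperDensity A - (2 - 1 / ((ℓ : ℝ) + m))) / 4, by linarith, by linarith⟩
  have hα : ∀ᶠ N : ℕ in atTop, lowerDensity A - δ <
      (((Finset.Icc 1 N).filter (· ∈ A)).card : ℝ) / N := by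
    apply eventually_lt_of_lt_liminf
    · unfold lowerDensity at *
      convert sub_lt_self _ hδ using 1
    · exact isBoundedUnder_of ⟨0, fun N => h0 N⟩
  have hβ : ∃ᶠ N : ℕ in atTop, upperDensity A - δ <
      (((Finset.Icc 1 N).filter (· ∈ A)).card : ℝ) / N := by
    apply frequently_lt_of_lt_limsup
    · exact (isBoundedUnder_of ⟨0, fun N => h0 N⟩ : IsBoundedUnder (· ≥ ·) atTop _).isCoboundedUnder_le
    · unfold upperDensity at *
      convert sub_lt_self _ hδ using 1
  refine MBLB.core A hℓ hm (α := lowerDensity A - δ) (β := upperDensity A - δ) ?_ ?_ ?_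
  · filter_upwards [hα] with N hN
    rw [MBLB.sum_ind]
    convert hN.le
  · refine hβ.mono (fun N hN => ?_)
    rw [MBLB.sum_ind]
    convert hN.le
  · have h2 : (1 - (lowerDensity A - δ)) + (1 - (upperDensity A - δ)) < 1 / ((ℓ : ℝ) + m) := by
      linarith
    rw [lt_div_iff₀ hq] at h2
    linarith
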